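/- Let Γ be a finite-dimensional algebra over a field with domdim Γ = d > 0 and maximal projective-injective summand Π. Let e_0, e^0 ∈ Γ be idempotents with Π = Γe_0 = D(e^0Γ), let e_k ∈ B_k be the idempotent given by projection onto the summand Π of the k-shifted module T_k, and let e^k ∈ B^k be the idempotent given by projection onto the summand Π of the k-coshifted module C^k. Then for all 0 ≤ k ≤ d there are algebra isomorphisms B_k/B_k e_k B_k ≅ Γ/Γe_0Γ and B^k/B^k e^k B^k ≅ Γ/Γe^0Γ. -/

import Mathlib

/-!
Formalization of definitions from "Special tilting modules for algebras with positive
dominant dimension" (Pressland–Sauter), together with one of its statements.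
-/

open CategoryTheory

noncomputable section
namespace PS

variable {R : Type} [Ring R]

/-- `N` is (isomorphic to) a direct summand of `M`. -/
def IsSummand (N M : ModuleCat.{0} R) : Prop :=
  ∃ (ι : N →ₗ[R] M) (π : M →ₗ[R] N), π ∘ₗ ι = LinearMap.id

/-- `M` lies in `add X`: it is a direct summand of a finite direct sum of copies of `X`. -/
def MemAdd (X M : ModuleCat.{0} R) : Prop :=
  ∃ n : ℕ, IsSummand M (ModuleCat.of R (Fin n → X))

/-- `M` is projective-injective. -/
def ProjInj (M : ModuleCat.{0} R) : Prop :=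
  Module.Projective R M ∧ Module.Injective R M

/-- The regular left module. -/
def reg (R : Type) [Ring R] : ModuleCat.{0} R := ModuleCat.of R R

/-- A module is basic if no nonzero module `X` has `X ⊕ X` as a direct summand of it
(equivalently, for finite length modules, its indecomposable direct summands are pairwise
non-isomorphic). -/
def IsBasic (M : ModuleCat.{0} R) : Prop :=
  ∀ X : ModuleCat.{0} R, IsSummand (ModuleCat.of R (X × X)) M → Subsingleton X

/-- `P` is a maximal projective-injective direct summand of the regular module. -/
def IsMaxProjInjSummand (P : ModuleCat.{0} R) : Prop :=
  IsSummand P (reg R) ∧ ProjInj P ∧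
    ∀ Q : ModuleCat.{0} R, IsSummand Q (reg R) → ProjInj Q → MemAdd P Q

/-- The data `Y 0 → Y 1 → ⋯ → Y n` forms an exact sequence
`0 → Y 0 → Y 1 → ⋯ → Y n → 0` (with `n ≥ 1` maps; terms beyond `Y n` are ignored). -/
def IsExactSeq (n : ℕ) (Y : ℕ → ModuleCat.{0} R) (f : ∀ i, Y i →ₗ[R] Y (i+1)) : Prop :=
  Function.Injective (f 0) ∧ Function.Surjective (f (n-1)) ∧
    ∀ i, i + 2 ≤ n → Function.Exact (f i) (f (i+1))

/-- The algebra `R` has dominant dimension at least `k`: the regular module has an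
injective resolution whose first `k` terms are projective-injective. -/
def DomdimGE (R : Type) [Ring R] (k : ℕ) : Prop :=
  ∃ (Y : ℕ → ModuleCat.{0} R) (g : reg R →ₗ[R] Y 0) (f : ∀ i, Y i →ₗ[R] Y (i+1)),
    Function.Injective g ∧ Function.Exact g (f 0) ∧
    (∀ i, Function.Exact (f i) (f (i+1))) ∧
    (∀ i, Module.Injective R (Y i)) ∧ (∀ i, i < k → Module.Projective R (Y i))

/-- `domdim R = d`. -/
def DomdimEq (R : Type) [Ring R] (d : ℕ) : Prop :=
  DomdimGE R d ∧ ¬ DomdimGE R (d+1)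

/-- The Ext group `Ext^j(M, N)` in the category of `R`-modules. -/
def ext (M N : ModuleCat.{0} R) (j : ℕ) : Type :=
  ((Ext ℤ (ModuleCat.{0} R) j).obj (Opposite.op M)).obj N

/-- `Ext^j(M, N) = 0` (for a single `j`). -/
def ExtZero (M N : ModuleCat.{0} R) (j : ℕ) : Prop := Subsingleton (ext M N j)

/-- `Ext^j(M, N) = 0` for all `j ≥ 1`. -/
def ExtVanishing (M N : ModuleCat.{0} R) : Prop :=
  ∀ j : ℕ, 1 ≤ j → ExtZero M N j

/-- Projective dimension at most `k`. -/
def PdimLE (k : ℕ) (M : ModuleCat.{0} R) : Prop :=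
  ∃ (Y : ℕ → ModuleCat.{0} R) (f : ∀ i, Y i →ₗ[R] Y (i+1)),
    IsExactSeq (k+1) Y f ∧ (∀ i, i ≤ k → Module.Projective R (Y i)) ∧ Y (k+1) = M

/-- Injective dimension at most `k`. -/
def IdimLE (k : ℕ) (M : ModuleCat.{0} R) : Prop :=
  ∃ (Y : ℕ → ModuleCat.{0} R) (f : ∀ i, Y i →ₗ[R] Y (i+1)),
    IsExactSeq (k+1) Y f ∧ (∀ i, 1 ≤ i → i ≤ k+1 → Module.Injective R (Y i)) ∧ Y 0 = M

/-- `T` is a `k`-tilting module. -/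
def IsTilting (k : ℕ) (T : ModuleCat.{0} R) : Prop :=
  Module.Finite R T ∧ PdimLE k T ∧ ExtVanishing T T ∧
    ∃ (Y : ℕ → ModuleCat.{0} R) (f : ∀ i, Y i →ₗ[R] Y (i+1)),
      IsExactSeq (k+1) Y f ∧ Y 0 = reg R ∧ ∀ i, 1 ≤ i → i ≤ k+1 → MemAdd T (Y i)

/-- `T` is a `P`-special `k`-tilting module: it is `k`-tilting, and there is a coresolution
`0 → R → t_0 → ⋯ → t_k → 0` with all `t_j ∈ add T` and `t_j ∈ add P` for `j ≤ k-1`. -/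
def IsSpecialTilting (P : ModuleCat.{0} R) (k : ℕ) (T : ModuleCat.{0} R) : Prop :=
  IsTilting k T ∧
    ∃ (Y : ℕ → ModuleCat.{0} R) (f : ∀ i, Y i →ₗ[R] Y (i+1)),
      IsExactSeq (k+1) Y f ∧ Y 0 = reg R ∧ (∀ i, 1 ≤ i → i ≤ k+1 → MemAdd T (Y i)) ∧
        (∀ i, 1 ≤ i → i ≤ k → MemAdd P (Y i))

/-- `M ∈ gen_k(X)`: there is an exact sequence `X^k → ⋯ → X^0 → M → 0` with `X^i ∈ add X`. -/
def MemGen (k : ℕ) (X M : ModuleCat.{0} R) : Prop :=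
  ∃ (Y : ℕ → ModuleCat.{0} R) (f : ∀ i, Y i →ₗ[R] Y (i+1)),
    (∀ i, i ≤ k → MemAdd X (Y i)) ∧ Y (k+1) = M ∧
    Function.Surjective (f k) ∧ ∀ i, i < k → Function.Exact (f i) (f (i+1))

/-- `M ∈ cogen^k(X)`: there is an exact sequence `0 → M → X_0 → ⋯ → X_k` with `X_i ∈ add X`. -/
def MemCogen (k : ℕ) (X M : ModuleCat.{0} R) : Prop :=
  ∃ (Y : ℕ → ModuleCat.{0} R) (f : ∀ i, Y i →ₗ[R] Y (i+1)),
    (∀ i, 1 ≤ i → i ≤ k+1 → MemAdd X (Y i)) ∧ Y 0 = M ∧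
    Function.Injective (f 0) ∧ ∀ i, i < k → Function.Exact (f i) (f (i+1))

/-- `M ∈ gen_{k-1}(X)`, where `gen_{-1}(X)` is the whole module category. -/
def MemGenShift : ℕ → ModuleCat.{0} R → ModuleCat.{0} R → Prop
  | 0, _X, _M => True
  | (k+1), X, M => MemGen k X M

/-- `M ∈ cogen^{k-1}(X)`, where `cogen^{-1}(X)` is the whole module category. -/
def MemCogenShift : ℕ → ModuleCat.{0} R → ModuleCat.{0} R → Prop
  | 0, _X, _M => True
  | (k+1), X, M => MemCogen k X M

/-- Global dimension at most `n` (on finitely generated modules). -/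
def GldimLE (R : Type) [Ring R] (n : ℕ) : Prop :=
  ∀ M : ModuleCat.{0} R, Module.Finite R M → PdimLE n M

/-- Global dimension exactly `n`. -/
def GldimEq (R : Type) [Ring R] (n : ℕ) : Prop :=
  GldimLE R n ∧ ∀ m : ℕ, GldimLE R m → n ≤ m

section Duality

variable (K : Type) [Field K]

section DualDefs
variable (S M : Type) [Semiring S] [AddCommGroup M] [Module K M]

/-- The action of `s : S` as a `K`-linear endomorphism. -/
def actMap [Module S M] [SMulCommClass S K M] (s : S) : M →ₗ[K] M where
  toFun m := s • m
  map_add' := smul_add s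
  map_smul' c m := (smul_comm s c m)

/-- The `K`-linear dual of a left `S`-module is a left `Sᵐᵒᵖ`-module (i.e. a right
`S`-module), by precomposition. -/
def dualModuleOp [Module S M] [SMulCommClass S K M] : Module Sᵐᵒᵖ (M →ₗ[K] K) where
  smul s φ := φ ∘ₗ actMap K S M s.unop
  one_smul φ := by ext m; exact congrArg φ (one_smul S m)
  mul_smul s t φ := by ext m; exact congrArg φ (mul_smul t.unop s.unop m)
  smul_zero s := by ext m; rfl
  smul_add s φ ψ := by ext m; rfl
  add_smul s t φ := by
    ext m
    show φ ((s.unop + t.unop) • m) = φ (s.unop • m) + φ (t.unop • m)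
    rw [add_smul, map_add]
  zero_smul φ := by
    ext m
    show φ ((0 : S) • m) = 0
    rw [zero_smul, map_zero]

/-- The `K`-linear dual of a right `S`-module is a left `S`-module, by precomposition. -/
def dualModuleUnop [Module Sᵐᵒᵖ M] [SMulCommClass Sᵐᵒᵖ K M] : Module S (M →ₗ[K] K) where
  smul s φ := φ ∘ₗ actMap K Sᵐᵒᵖ M (MulOpposite.op s)
  one_smul φ := by ext m; exact congrArg φ (one_smul Sᵐᵒᵖ m)
  mul_smul s t φ := by
    ext m
    show φ (MulOpposite.op (s * t) • m) = φ (MulOpposite.op t • MulOpposite.op s • m)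
    rw [← mul_smul]
    rfl
  smul_zero s := by ext m; rfl
  smul_add s φ ψ := by ext m; rfl
  add_smul s t φ := by
    ext m
    show φ ((MulOpposite.op s + MulOpposite.op t) • m)
      = φ (MulOpposite.op s • m) + φ (MulOpposite.op t • m)
    rw [add_smul, map_add]
  zero_smul φ := by
    ext m
    show φ ((0 : Sᵐᵒᵖ) • m) = 0
    rw [zero_smul, map_zero]

end DualDefs

/-- `D R`: the `K`-linear dual of the right regular module, as a left `R`-module. -/
def Dreg (R : Type) [Ring R] [Algebra K R] : ModuleCat.{0} R :=
  letI : Module R (R →ₗ[K] K) := dualModuleUnop K R R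
  ModuleCat.of R (R →ₗ[K] K)

variable {R : Type} [Ring R] [Algebra K R]

/-- The `K`-module structure on an `R`-module, via restriction of scalars. -/
def kMod (M : ModuleCat.{0} R) : Module K M := Module.compHom M (algebraMap K R)

theorem kMod_smulCommClass (M : ModuleCat.{0} R) :
    letI := kMod K M; SMulCommClass R K M := by
  letI := kMod K M
  constructor
  intro r c m
  show r • (algebraMap K R c • m) = algebraMap K R c • (r • m)
  rw [← mul_smul, ← mul_smul, Algebra.commutes]

theorem kMod_end_smulCommClass (M : ModuleCat.{0} R) :
    letI := kMod K M; SMulCommClass (Module.End R M) K M := by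
  letI := kMod K M
  constructor
  intro f c m
  show f (algebraMap K R c • m) = algebraMap K R c • f m
  rw [map_smul]

/-- The dual `D T` of a left `R`-module `T`, as a left module over `B = End_R(T)ᵒᵖ`. -/
def DT (T : ModuleCat.{0} R) : ModuleCat.{0} ((Module.End R T)ᵐᵒᵖ) :=
  letI := kMod K T
  letI := kMod_end_smulCommClass K T
  letI : Module (Module.End R T)ᵐᵒᵖ (T →ₗ[K] K) := dualModuleOp K (Module.End R T) T
  ModuleCat.of _ (T →ₗ[K] K)

/-- `C` is a `k`-cotilting module. -/
def IsCotilting (k : ℕ) (C : ModuleCat.{0} R) : Prop :=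
  Module.Finite R C ∧ IdimLE k C ∧ ExtVanishing C C ∧
    ∃ (Y : ℕ → ModuleCat.{0} R) (f : ∀ i, Y i →ₗ[R] Y (i+1)),
      IsExactSeq (k+1) Y f ∧ Y (k+1) = Dreg K R ∧ ∀ i, i ≤ k → MemAdd C (Y i)

/-- `C` is an `I`-special `k`-cotilting module: it is `k`-cotilting, and there is a resolution
`0 → c^k → ⋯ → c^0 → D R → 0` with all `c^j ∈ add C` and `c^j ∈ add I` for `j ≤ k-1`. -/
def IsSpecialCotilting (I : ModuleCat.{0} R) (k : ℕ) (C : ModuleCat.{0} R) : Prop :=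
  IsCotilting K k C ∧
    ∃ (Y : ℕ → ModuleCat.{0} R) (f : ∀ i, Y i →ₗ[R] Y (i+1)),
      IsExactSeq (k+1) Y f ∧ Y (k+1) = Dreg K R ∧ (∀ i, i ≤ k → MemAdd C (Y i)) ∧
        (∀ i, 1 ≤ i → i ≤ k → MemAdd I (Y i))

/-- `R` is a `d`-Auslander–Gorenstein algebra: `id R ≤ d+1 ≤ domdim R`. -/
def IsAuslanderGorenstein (R : Type) [Ring R] (d : ℕ) : Prop :=
  IdimLE (d+1) (reg R) ∧ DomdimGE R (d+1)

/-- `R` is a `d`-Auslander algebra: `gldim R ≤ d+1 ≤ domdim R`. -/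
def IsAuslander (R : Type) [Ring R] (d : ℕ) : Prop :=
  GldimLE R (d+1) ∧ DomdimGE R (d+1)

end Duality

section EndAlgebra

variable (K : Type) [Field K] {Γ : Type} [Ring Γ] [Algebra K Γ]

/-- For `Γ`-modules `T`, `X`, the Hom-space `Hom_Γ(T, X)` is a left module over
`B = End_Γ(T)ᵒᵖ` by precomposition. -/
def homEndModule (T X : ModuleCat.{0} Γ) : Module (Module.End Γ T)ᵐᵒᵖ (T →ₗ[Γ] X) where
  smul f φ := φ ∘ₗ f.unop
  one_smul φ := by ext t; rfl
  mul_smul f g φ := by ext t; rfl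
  smul_zero f := by ext t; rfl
  smul_add f φ ψ := by ext t; rfl
  add_smul f g φ := by ext t; exact map_add φ _ _
  zero_smul φ := by ext t; exact map_zero φ

/-- `Hom_Γ(T, X)` as a module over `B = End_Γ(T)ᵒᵖ`. -/
def homTX (T X : ModuleCat.{0} Γ) : ModuleCat.{0} ((Module.End Γ T)ᵐᵒᵖ) :=
  letI := homEndModule T X
  ModuleCat.of _ (T →ₗ[Γ] X)

/-- `D Hom_Γ(P, T)`, the dual of `Hom_Γ(P, T)`, as a left module over `B = End_Γ(T)ᵒᵖ`. -/
def Ihom (P T : ModuleCat.{0} Γ) : ModuleCat.{0} ((Module.End Γ T)ᵐᵒᵖ) :=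
  letI := kMod K T
  letI := kMod_smulCommClass K T
  letI := kMod_end_smulCommClass K T
  letI : SMulCommClass (Module.End Γ T) K (P →ₗ[Γ] T) :=
    ⟨fun f c φ => LinearMap.ext fun p => smul_comm f c (φ p)⟩
  letI : Module (Module.End Γ T)ᵐᵒᵖ ((P →ₗ[Γ] T) →ₗ[K] K) :=
    dualModuleOp K (Module.End Γ T) (P →ₗ[Γ] T)
  ModuleCat.of _ ((P →ₗ[Γ] T) →ₗ[K] K)

/-- The scalar action of `K` on `End_Γ(T)`, as a `Γ`-linear endomorphism of `T`. -/
def centralEnd (T : ModuleCat.{0} Γ) (c : K) : Module.End Γ T where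
  toFun t := algebraMap K Γ c • t
  map_add' := smul_add _
  map_smul' γ t := by
    simp only [RingHom.id_apply]
    rw [← mul_smul, ← mul_smul, Algebra.commutes]

/-- `End_Γ(T)` is a `K`-algebra. -/
instance endAlgebra (T : ModuleCat.{0} Γ) : Algebra K (Module.End Γ T) :=
  RingHom.toAlgebra'
    { toFun := centralEnd K T
      map_one' := by
        ext t
        show algebraMap K Γ 1 • t = t
        rw [map_one, one_smul]
      map_mul' := fun c d => by
        ext t
        show (algebraMap K Γ (c * d)) • t = algebraMap K Γ c • algebraMap K Γ d • t
        rw [map_mul, mul_smul]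
      map_zero' := by
        ext t
        show algebraMap K Γ 0 • t = 0
        rw [map_zero, zero_smul]
      map_add' := fun c d => by
        ext t
        show (algebraMap K Γ (c + d)) • t = algebraMap K Γ c • t + algebraMap K Γ d • t
        rw [map_add, add_smul] }
    (by
      intro c f
      ext t
      show algebraMap K Γ c • f t = f (algebraMap K Γ c • t)
      rw [map_smul])

/-- The right action of `s : S` on a `(B, S)`-bimodule, as a `B`-linear endomorphism. -/
def bact (B S M : Type) [Ring B] [Semiring S] [AddCommGroup M] [Module B M] [Module Sᵐᵒᵖ M]
    [SMulCommClass Sᵐᵒᵖ B M] (s : S) : M →ₗ[B] M where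
  toFun m := MulOpposite.op s • m
  map_add' := smul_add _
  map_smul' b m := smul_comm (MulOpposite.op s) b m

/-- For a `(B, S)`-bimodule `M` and a left `B`-module `I`, the Hom-space `Hom_B(M, I)` is a
left `S`-module by precomposition with the right `S`-action. -/
def homBimodule (B S M I : Type) [Ring B] [Semiring S] [AddCommGroup M] [Module B M]
    [AddCommGroup I] [Module B I] [Module Sᵐᵒᵖ M] [SMulCommClass Sᵐᵒᵖ B M] :
    Module S (M →ₗ[B] I) where
  smul s f := f ∘ₗ bact B S M s
  one_smul f := by ext m; exact congrArg f (one_smul Sᵐᵒᵖ m)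
  mul_smul s t f := by
    ext m
    exact congrArg f (mul_smul (MulOpposite.op t) (MulOpposite.op s) m)
  smul_zero s := by ext m; rfl
  smul_add s f g := by ext m; rfl
  add_smul s t f := by
    ext m
    show f ((MulOpposite.op s + MulOpposite.op t) • m)
      = f (MulOpposite.op s • m) + f (MulOpposite.op t • m)
    rw [add_smul, map_add]
  zero_smul f := by
    ext m
    show f ((0 : Sᵐᵒᵖ) • m) = 0
    rw [zero_smul, map_zero]

/-- The Nakayama functor `ν = D Hom_B(-, B)` applied to a `B'`-module `P`. -/
def Nakayama (B' : Type) [Ring B'] [Algebra K B'] (P : ModuleCat.{0} B') : ModuleCat.{0} B' :=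
  letI : SMulCommClass B'ᵐᵒᵖ K (P →ₗ[B'] B') :=
    ⟨fun s c φ => LinearMap.ext fun p => smul_comm s c (φ p)⟩
  letI : Module B' ((P →ₗ[B'] B') →ₗ[K] K) := dualModuleUnop K B' (P →ₗ[B'] B')
  ModuleCat.of B' ((P →ₗ[B'] B') →ₗ[K] K)

/-- The inverse Nakayama functor `ν⁻ = Hom_B(D B, -)` applied to a `B'`-module `I`. -/
def NakayamaInv (B' : Type) [Ring B'] [Algebra K B'] (I : ModuleCat.{0} B') :
    ModuleCat.{0} B' :=
  letI : Module B' (B' →ₗ[K] K) := dualModuleUnop K B' B'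
  letI : Module B'ᵐᵒᵖ (B' →ₗ[K] K) := dualModuleOp K B' B'
  letI : SMulCommClass B'ᵐᵒᵖ B' (B' →ₗ[K] K) :=
    ⟨fun b γ φ => LinearMap.ext fun x => congrArg φ (mul_assoc b.unop x γ)⟩
  letI : Module B' ((B' →ₗ[K] K) →ₗ[B'] I) := homBimodule B' B' (B' →ₗ[K] K) I
  ModuleCat.of B' ((B' →ₗ[K] K) →ₗ[B'] I)

end EndAlgebra

section
variable (K : Type) [Field K] {Γ : Type} [Ring Γ] [Algebra K Γ]

/-- The `K`-linear dual of a left `Γ`-module, as a right `Γ`-module. -/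
def Dmod (X : ModuleCat.{0} Γ) : ModuleCat.{0} Γᵐᵒᵖ :=
  letI := kMod K X
  letI := kMod_smulCommClass K X
  letI : Module Γᵐᵒᵖ (X →ₗ[K] K) := dualModuleOp K Γ X
  ModuleCat.of _ (X →ₗ[K] K)

end
end PS
end

noncomputable section
namespace PS

section Summands

variable {R : Type} [Ring R] {M N L X Y : ModuleCat.{0} R}

theorem IsSummand.refl (M : ModuleCat.{0} R) : IsSummand M M :=
  ⟨LinearMap.id, LinearMap.id, rfl⟩

theorem IsSummand.trans (h : IsSummand M N) (h' : IsSummand N L) : IsSummand M L := by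
  obtain ⟨i, p, hp⟩ := h
  obtain ⟨j, q, hq⟩ := h'
  refine ⟨j ∘ₗ i, p ∘ₗ q, LinearMap.ext fun x => ?_⟩
  have h1 := LinearMap.congr_fun hq (i x)
  have h2 := LinearMap.congr_fun hp x
  simp only [LinearMap.comp_apply, LinearMap.id_apply] at h1 h2 ⊢
  rw [h1, h2]

theorem IsSummand.of_equiv (e : M ≃ₗ[R] N) : IsSummand M N :=
  ⟨e.toLinearMap, e.symm.toLinearMap, by ext; simp⟩

theorem IsSummand.inl (M N : ModuleCat.{0} R) : IsSummand M (ModuleCat.of R (M × N)) :=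
  ⟨LinearMap.inl R M N, LinearMap.fst R M N, rfl⟩

theorem IsSummand.inr (M N : ModuleCat.{0} R) : IsSummand N (ModuleCat.of R (M × N)) :=
  ⟨LinearMap.inr R M N, LinearMap.snd R M N, rfl⟩

theorem IsSummand.prodMap {M' N' : ModuleCat.{0} R} (h : IsSummand M N) (h' : IsSummand M' N') :
    IsSummand (ModuleCat.of R (M × M')) (ModuleCat.of R (N × N')) := by
  obtain ⟨i, p, hp⟩ := h
  obtain ⟨j, q, hq⟩ := h'
  refine ⟨i.prodMap j, p.prodMap q, ?_⟩
  exact (LinearMap.prodMap_comp _ _ _ _).trans (by rw [hp, hq, LinearMap.prodMap_id])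

theorem IsSummand.piMap (n : ℕ) (h : IsSummand M N) :
    IsSummand (ModuleCat.of R (Fin n → M)) (ModuleCat.of R (Fin n → N)) := by
  obtain ⟨i, p, hp⟩ := h
  refine ⟨i.compLeft (Fin n), p.compLeft (Fin n), LinearMap.ext fun x => funext fun a => ?_⟩
  exact LinearMap.congr_fun hp (x a)

theorem IsSummand.finite (h : IsSummand M N) [Module.Finite R N] : Module.Finite R M := by
  obtain ⟨i, p, hp⟩ := h
  exact Module.Finite.of_surjective p fun x => ⟨i x, LinearMap.congr_fun hp x⟩

theorem IsSummand.projective (h : IsSummand M N) (hN : Module.Projective R N) :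
    Module.Projective R M := by
  obtain ⟨i, p, hp⟩ := h
  exact Module.Projective.of_split i p hp

theorem IsSummand.injective (h : IsSummand M N) (hN : Module.Injective R N) :
    Module.Injective R M := by
  obtain ⟨i, p, hp⟩ := h
  refine ⟨fun X Y _ _ _ _ f hf g => ?_⟩
  obtain ⟨k, hk⟩ := hN.out f hf (i ∘ₗ g)
  refine ⟨p ∘ₗ k, fun x => ?_⟩
  rw [LinearMap.comp_apply, hk]
  exact LinearMap.congr_fun hp (g x)

theorem IsBasic.of_isSummand (hN : IsBasic N) (h : IsSummand M N) : IsBasic M :=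
  fun X hX => hN X (hX.trans h)

theorem MemAdd.of_isSummand (hN : MemAdd X N) (h : IsSummand M N) : MemAdd X M := by
  obtain ⟨n, hn⟩ := hN
  exact ⟨n, h.trans hn⟩

theorem MemAdd.self (X : ModuleCat.{0} R) : MemAdd X X :=
  ⟨1, IsSummand.of_equiv (LinearEquiv.funUnique (Fin 1) R X).symm⟩

theorem IsSummand.memAdd (h : IsSummand M X) : MemAdd X M := (MemAdd.self X).of_isSummand h

theorem MemAdd.prod (hM : MemAdd X M) (hN : MemAdd X N) :
    MemAdd X (ModuleCat.of R (M × N)) := by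
  obtain ⟨m, hm⟩ := hM
  obtain ⟨n, hn⟩ := hN
  refine ⟨m + n, (hm.prodMap hn).trans (IsSummand.of_equiv ?_)⟩
  exact (LinearEquiv.sumArrowLequivProdArrow (Fin m) (Fin n) R X).symm ≪≫ₗ
    LinearEquiv.funCongrLeft R X finSumFinEquiv.symm

theorem MemAdd.pi (n : ℕ) (hM : MemAdd X M) : MemAdd X (ModuleCat.of R (Fin n → M)) := by
  obtain ⟨m, hm⟩ := hM
  refine ⟨n * m, (hm.piMap n).trans (IsSummand.of_equiv ?_)⟩
  exact (LinearEquiv.curry R X (Fin n) (Fin m)).symm ≪≫ₗ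
    LinearEquiv.funCongrLeft R X finProdFinEquiv.symm

theorem MemAdd.trans (hX : MemAdd Y X) (hM : MemAdd X M) : MemAdd Y M := by
  obtain ⟨n, hn⟩ := hM
  exact (hX.pi n).of_isSummand hn

theorem MemAdd.finite (h : MemAdd X M) [Module.Finite R X] : Module.Finite R M := by
  obtain ⟨n, hn⟩ := h
  have : Module.Finite R (ModuleCat.of R (Fin n → X)) :=
    inferInstanceAs (Module.Finite R (Fin n → X))
  exact hn.finite

theorem MemAdd.projective (h : MemAdd X M) (hX : Module.Projective R X) :
    Module.Projective R M := by
  obtain ⟨n, hn⟩ := h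
  exact hn.projective
    (Module.Projective.of_equiv
      (DFinsupp.linearEquivFunOnFintype (R := R) (M := fun _ : Fin n => X)))

theorem MemAdd.injective (h : MemAdd X M) (hX : Module.Injective R X) :
    Module.Injective R M := by
  obtain ⟨n, hn⟩ := h
  refine hn.injective ⟨fun A B _ _ _ _ f hf g => ?_⟩
  choose k hk using fun a : Fin n => hX.out f hf (LinearMap.proj a ∘ₗ g)
  exact ⟨LinearMap.pi k, fun x => funext fun a => hk a x⟩

end Summands

section Factor

variable {R : Type} [Ring R] {P : ModuleCat.{0} R} {M N L : ModuleCat.{0} R}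

/-- The linear map `φ` factors through a module in `add P`. -/
def Factors (P : ModuleCat.{0} R) {M N : ModuleCat.{0} R} (φ : M →ₗ[R] N) : Prop :=
  ∃ Q : ModuleCat.{0} R, MemAdd P Q ∧ ∃ (g : M →ₗ[R] Q) (h : Q →ₗ[R] N), φ = h ∘ₗ g

theorem Factors.comp_left {φ : M →ₗ[R] N} (h : Factors P φ) (ψ : N →ₗ[R] L) :
    Factors P (ψ ∘ₗ φ) := by
  obtain ⟨Q, hQ, a, b, rfl⟩ := h
  exact ⟨Q, hQ, a, ψ ∘ₗ b, rfl⟩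

theorem Factors.comp_right {φ : M →ₗ[R] N} (h : Factors P φ) (ψ : L →ₗ[R] M) :
    Factors P (φ ∘ₗ ψ) := by
  obtain ⟨Q, hQ, a, b, rfl⟩ := h
  exact ⟨Q, hQ, a ∘ₗ ψ, b, rfl⟩

theorem Factors.add {φ ψ : M →ₗ[R] N} (h : Factors P φ) (h' : Factors P ψ) :
    Factors P (φ + ψ) := by
  obtain ⟨Q, hQ, a, b, rfl⟩ := h
  obtain ⟨Q', hQ', a', b', rfl⟩ := h'
  exact ⟨ModuleCat.of R (Q × Q'), hQ.prod hQ', a.prod a', b.coprod b', by ext; simp⟩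

theorem Factors.neg {φ : M →ₗ[R] N} (h : Factors P φ) : Factors P (-φ) := by
  simpa using h.comp_left (-LinearMap.id)

theorem Factors.sub {φ ψ : M →ₗ[R] N} (h : Factors P φ) (h' : Factors P ψ) :
    Factors P (φ - ψ) := by
  rw [sub_eq_add_neg]
  exact h.add h'.neg

theorem Factors.zero : Factors P (0 : M →ₗ[R] N) :=
  ⟨P, MemAdd.self P, 0, 0, by simp⟩

/-- `M` is a retract of `N` modulo maps factoring through `add P`. -/
def StableRetract (P M N : ModuleCat.{0} R) : Prop :=
  ∃ (i : M →ₗ[R] N) (p : N →ₗ[R] M), Factors P (p ∘ₗ i - LinearMap.id)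

theorem IsSummand.stableRetract (h : IsSummand M N) : StableRetract P M N := by
  obtain ⟨i, p, h⟩ := h
  exact ⟨i, p, by rw [h, sub_self]; exact Factors.zero⟩

theorem StableRetract.exists_isSummand (h : StableRetract P M N) :
    ∃ Q, MemAdd P Q ∧ IsSummand M (ModuleCat.of R (N × Q)) := by
  obtain ⟨i, p, Q, hQ, a, b, h⟩ := h
  refine ⟨Q, hQ, i.prod a, p.coprod (-b), LinearMap.ext fun x => ?_⟩
  have := LinearMap.congr_fun h x
  simp only [LinearMap.sub_apply, LinearMap.comp_apply, LinearMap.id_apply] at this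
  simp [← this]

theorem StableRetract.memAdd {n : ℕ} (h : StableRetract P M (ModuleCat.of R (Fin n → N))) :
    MemAdd (ModuleCat.of R (N × P)) M := by
  obtain ⟨Q, hQ, h⟩ := h.exists_isSummand
  refine MemAdd.of_isSummand (MemAdd.prod ?_ ?_) h
  · exact MemAdd.pi n (IsSummand.inl N P).memAdd
  · exact (IsSummand.inr N P).memAdd.trans hQ

theorem StableRetract.of_isSummand_prod (h : IsSummand M (ModuleCat.of R (N × P))) :
    StableRetract P M N := by
  obtain ⟨i, p, h⟩ := h
  refine ⟨LinearMap.fst R N P ∘ₗ i, p ∘ₗ LinearMap.inl R N P, P, MemAdd.self P,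
    LinearMap.snd R N P ∘ₗ i, -(p ∘ₗ LinearMap.inr R N P), LinearMap.ext fun x => ?_⟩
  have h1 := LinearMap.congr_fun h x
  have h2 : (i x : N × P) = LinearMap.inl R N P (i x).1 + LinearMap.inr R N P (i x).2 := by
    ext <;> simp
  have h3 : p (LinearMap.inl R N P (i x).1) + p (LinearMap.inr R N P (i x).2) = x := by
    rw [← map_add, ← h2]; exact h1
  simp only [LinearMap.sub_apply, LinearMap.comp_apply, LinearMap.neg_apply, LinearMap.id_apply,
    LinearMap.fst_apply, LinearMap.snd_apply]
  rw [sub_eq_iff_eq_add, neg_add_eq_sub, eq_sub_iff_add_eq]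
  exact h3

end Factor

/-- Two quotient rings are isomorphic if they are related by a subring of the product which
surjects onto both factors and matches the kernels. -/
theorem nonempty_ringEquiv_of_subring {E F E' F' : Type} [Ring E] [Ring F] [Ring E'] [Ring F']
    (q : E →+* E') (r : F →+* F') (hq : Function.Surjective q) (hr : Function.Surjective r)
    (S : Subring (E × F)) (hE : ∀ a, ∃ b, (a, b) ∈ S) (hF : ∀ b, ∃ a, (a, b) ∈ S)
    (h : ∀ x ∈ S, q x.1 = 0 ↔ r x.2 = 0) : Nonempty (E' ≃+* F') := by
  let f : S →+* E' := q.comp ((RingHom.fst E F).comp S.subtype)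
  let g : S →+* F' := r.comp ((RingHom.snd E F).comp S.subtype)
  have hf : Function.Surjective f := fun y => by
    obtain ⟨a, rfl⟩ := hq y
    obtain ⟨b, hb⟩ := hE a
    exact ⟨⟨_, hb⟩, rfl⟩
  have hg : Function.Surjective g := fun y => by
    obtain ⟨b, rfl⟩ := hr y
    obtain ⟨a, ha⟩ := hF b
    exact ⟨⟨_, ha⟩, rfl⟩
  have hker : RingHom.ker f = RingHom.ker g := by
    ext x
    exact h x.1 x.2
  exact ⟨(RingHom.quotientKerEquivOfSurjective hf).symm.trans
    ((Ideal.quotEquivOfEq hker).trans (RingHom.quotientKerEquivOfSurjective hg))⟩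

section Shift

variable {R : Type} [Ring R] {P : ModuleCat.{0} R}

/-- The endomorphisms factoring through `add P`. -/
def factorsIdeal (P M : ModuleCat.{0} R) : Ideal (Module.End R M) where
  carrier := {φ | Factors P φ}
  add_mem' := Factors.add
  zero_mem' := Factors.zero
  smul_mem' c _ h := h.comp_left c

instance (P M : ModuleCat.{0} R) : (factorsIdeal P M).IsTwoSided :=
  ⟨fun b h => Factors.comp_right h b⟩

/-- The endomorphism ring of `M` modulo maps factoring through `add P`. -/
abbrev StableEnd (P M : ModuleCat.{0} R) : Type := Module.End R M ⧸ factorsIdeal P M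

theorem StableEnd.mk_eq_zero_iff {M : ModuleCat.{0} R} (φ : Module.End R M) :
    Ideal.Quotient.mk (factorsIdeal P M) φ = 0 ↔ Factors P φ :=
  Ideal.Quotient.eq_zero_iff_mem

/-- `0 → A → Q → B → 0` is exact. -/
structure IsShortExact {A Q B : ModuleCat.{0} R} (i : A →ₗ[R] Q) (p : Q →ₗ[R] B) : Prop where
  inj : Function.Injective i
  exact : Function.Exact i p
  surj : Function.Surjective p

section Step

variable {A Q B A' Q' B' A'' Q'' B'' : ModuleCat.{0} R}
  {i : A →ₗ[R] Q} {p : Q →ₗ[R] B} {i' : A' →ₗ[R] Q'} {p' : Q' →ₗ[R] B'}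
  {i'' : A'' →ₗ[R] Q''} {p'' : Q'' →ₗ[R] B''}

theorem IsShortExact.comp_eq_zero (h : IsShortExact i p) : p ∘ₗ i = 0 :=
  h.exact.linearMap_comp_eq_zero

theorem IsShortExact.exists_desc (h : IsShortExact i p) {X : ModuleCat.{0} R} (φ : Q →ₗ[R] X)
    (hφ : φ ∘ₗ i = 0) : ∃ ψ : B →ₗ[R] X, ψ ∘ₗ p = φ := by
  have hle : LinearMap.ker p ≤ LinearMap.ker φ := fun x hx => by
    obtain ⟨a, rfl⟩ := (h.exact x).1 hx
    exact LinearMap.congr_fun hφ a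
  refine ⟨(LinearMap.ker p).liftQ φ hle ∘ₗ
    (p.quotKerEquivOfSurjective h.surj).symm.toLinearMap, LinearMap.ext fun x => ?_⟩
  have : (p.quotKerEquivOfSurjective h.surj).symm (p x) = (LinearMap.ker p).mkQ x := by
    rw [LinearEquiv.symm_apply_eq]
    rfl
  simp only [LinearMap.comp_apply, LinearEquiv.coe_coe, this]
  rfl

theorem IsShortExact.exists_lift (h : IsShortExact i p) {X : ModuleCat.{0} R} (φ : X →ₗ[R] Q)
    (hφ : p ∘ₗ φ = 0) : ∃ ψ : X →ₗ[R] A, i ∘ₗ ψ = φ := by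
  have hmem : ∀ x, φ x ∈ LinearMap.range i := fun x =>
    (h.exact (φ x)).1 (LinearMap.congr_fun hφ x)
  refine ⟨(LinearEquiv.ofInjective i h.inj).symm.toLinearMap ∘ₗ φ.codRestrict _ hmem,
    LinearMap.ext fun x => ?_⟩
  exact congrArg Subtype.val
    ((LinearEquiv.ofInjective i h.inj).apply_symm_apply (φ.codRestrict _ hmem x))

/-- `α` and `β` are the outer terms of a morphism between two sequences. -/
def Linked (i : A →ₗ[R] Q) (p : Q →ₗ[R] B) (i' : A' →ₗ[R] Q') (p' : Q' →ₗ[R] B')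
    (α : A →ₗ[R] A') (β : B →ₗ[R] B') : Prop :=
  ∃ q : Q →ₗ[R] Q', q ∘ₗ i = i' ∘ₗ α ∧ p' ∘ₗ q = β ∘ₗ p

theorem Linked.id : Linked i p i p LinearMap.id LinearMap.id := ⟨LinearMap.id, rfl, rfl⟩

theorem Linked.comp {α : A →ₗ[R] A'} {β : B →ₗ[R] B'} {α' : A' →ₗ[R] A''} {β' : B' →ₗ[R] B''}
    (h : Linked i p i' p' α β) (h' : Linked i' p' i'' p'' α' β') :
    Linked i p i'' p'' (α' ∘ₗ α) (β' ∘ₗ β) := by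
  obtain ⟨q, h1, h2⟩ := h
  obtain ⟨q', h1', h2'⟩ := h'
  refine ⟨q' ∘ₗ q, ?_, ?_⟩
  · rw [LinearMap.comp_assoc, h1, ← LinearMap.comp_assoc, h1', LinearMap.comp_assoc]
  · rw [← LinearMap.comp_assoc, h2', LinearMap.comp_assoc, h2, LinearMap.comp_assoc]

theorem Linked.add {α γ : A →ₗ[R] A'} {β δ : B →ₗ[R] B'}
    (h : Linked i p i' p' α β) (h' : Linked i p i' p' γ δ) :
    Linked i p i' p' (α + γ) (β + δ) := by
  obtain ⟨q, h1, h2⟩ := h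
  obtain ⟨q', h1', h2'⟩ := h'
  exact ⟨q + q', by rw [LinearMap.add_comp, LinearMap.comp_add, h1, h1'],
    by rw [LinearMap.add_comp, LinearMap.comp_add, h2, h2']⟩

theorem Linked.neg {α : A →ₗ[R] A'} {β : B →ₗ[R] B'} (h : Linked i p i' p' α β) :
    Linked i p i' p' (-α) (-β) := by
  obtain ⟨q, h1, h2⟩ := h
  exact ⟨-q, by rw [LinearMap.neg_comp, LinearMap.comp_neg, h1],
    by rw [LinearMap.neg_comp, LinearMap.comp_neg, h2]⟩

theorem Linked.sub {α γ : A →ₗ[R] A'} {β δ : B →ₗ[R] B'}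
    (h : Linked i p i' p' α β) (h' : Linked i p i' p' γ δ) :
    Linked i p i' p' (α - γ) (β - δ) := by
  simpa [sub_eq_add_neg] using h.add h'.neg

theorem Linked.exists_right (h : IsShortExact i p) (h' : IsShortExact i' p')
    (hQ' : Module.Injective R Q') (α : A →ₗ[R] A') : ∃ β, Linked i p i' p' α β := by
  obtain ⟨q, hq⟩ := hQ'.out i h.inj (i' ∘ₗ α)
  have hq : q ∘ₗ i = i' ∘ₗ α := LinearMap.ext hq
  obtain ⟨β, hβ⟩ := h.exists_desc (p' ∘ₗ q)
    (by rw [LinearMap.comp_assoc, hq, ← LinearMap.comp_assoc, h'.comp_eq_zero,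
      LinearMap.zero_comp])
  exact ⟨β, q, hq, hβ.symm⟩

theorem Linked.exists_left (h : IsShortExact i p) (h' : IsShortExact i' p')
    (hQ : Module.Projective R Q) (β : B →ₗ[R] B') : ∃ α, Linked i p i' p' α β := by
  obtain ⟨q, hq⟩ := Module.projective_lifting_property p' (β ∘ₗ p) h'.surj
  obtain ⟨α, hα⟩ := h'.exists_lift (q ∘ₗ i)
    (by rw [← LinearMap.comp_assoc, hq, LinearMap.comp_assoc, h.comp_eq_zero,
      LinearMap.comp_zero])
  exact ⟨α, q, hα.symm, hq⟩

theorem Linked.factors_iff (h : IsShortExact i p) (h' : IsShortExact i' p')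
    (hP : ProjInj P) (hQ : MemAdd P Q) (hQ' : MemAdd P Q')
    {α : A →ₗ[R] A'} {β : B →ₗ[R] B'} (hl : Linked i p i' p' α β) :
    Factors P α ↔ Factors P β := by
  obtain ⟨q, h1, h2⟩ := hl
  constructor
  · rintro ⟨X, hX, a, b, rfl⟩
    obtain ⟨s, hs⟩ := (hX.injective hP.2).out i h.inj a
    obtain ⟨t, ht⟩ := h.exists_desc (q - i' ∘ₗ b ∘ₗ s) (by
      ext x
      have := LinearMap.congr_fun h1 x
      simp only [LinearMap.comp_apply] at this
      simp [hs, this])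
    have : β = p' ∘ₗ t := by
      rw [← LinearMap.cancel_right h.surj, LinearMap.comp_assoc, ht, LinearMap.comp_sub, h2,
        ← LinearMap.comp_assoc, h'.comp_eq_zero]
      simp
    exact ⟨Q', hQ', t, p', this⟩
  · rintro ⟨X, hX, a, b, rfl⟩
    have := hX.projective hP.1
    obtain ⟨s, hs⟩ := Module.projective_lifting_property p' b h'.surj
    obtain ⟨t, ht⟩ := h'.exists_lift (q - s ∘ₗ a ∘ₗ p) (by
      rw [LinearMap.comp_sub, h2, ← LinearMap.comp_assoc, hs, LinearMap.comp_assoc, sub_self])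
    have : α = t ∘ₗ i := by
      rw [← LinearMap.cancel_left h'.inj, ← LinearMap.comp_assoc, ht, LinearMap.sub_comp, h1]
      have := h.comp_eq_zero
      simp [LinearMap.comp_assoc, this]
    exact ⟨Q, hQ, i, t, this⟩

theorem IsShortExact.stableRetract_iff (h : IsShortExact i p) (h' : IsShortExact i' p')
    (hP : ProjInj P) (hQ : MemAdd P Q) (hQ' : MemAdd P Q') :
    StableRetract P A A' ↔ StableRetract P B B' := by
  constructor
  · rintro ⟨a, b, hab⟩
    obtain ⟨a', ha⟩ := Linked.exists_right h h' (hQ'.injective hP.2) a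
    obtain ⟨b', hb⟩ := Linked.exists_right h' h (hQ.injective hP.2) b
    exact ⟨a', b', (((ha.comp hb).sub .id).factors_iff h h hP hQ hQ).1 hab⟩
  · rintro ⟨a, b, hab⟩
    obtain ⟨a', ha⟩ := Linked.exists_left h h' (hQ.projective hP.1) a
    obtain ⟨b', hb⟩ := Linked.exists_left h' h (hQ'.projective hP.1) b
    exact ⟨a', b', (((ha.comp hb).sub .id).factors_iff h h hP hQ hQ).2 hab⟩

theorem IsShortExact.nonempty_stableEnd (h : IsShortExact i p) (hP : ProjInj P)
    (hQ : MemAdd P Q) : Nonempty (StableEnd P A ≃+* StableEnd P B) :=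
  nonempty_ringEquiv_of_subring (Ideal.Quotient.mk _) (Ideal.Quotient.mk _)
    Ideal.Quotient.mk_surjective Ideal.Quotient.mk_surjective
    { carrier := {x : Module.End R A × Module.End R B | Linked i p i p x.1 x.2}
      mul_mem' := fun hx hy => hy.comp hx
      one_mem' := Linked.id
      add_mem' := Linked.add
      zero_mem' := ⟨0, by simp, by simp⟩
      neg_mem' := Linked.neg }
    (Linked.exists_right h h (hQ.injective hP.2)) (Linked.exists_left h h (hQ.projective hP.1))
    (fun x hx => by
      rw [StableEnd.mk_eq_zero_iff, StableEnd.mk_eq_zero_iff]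
      exact Linked.factors_iff h h hP hQ hQ hx)

theorem IsShortExact.pi (h : IsShortExact i p) (n : ℕ) :
    IsShortExact (A := ModuleCat.of R (Fin n → A)) (Q := ModuleCat.of R (Fin n → Q))
      (B := ModuleCat.of R (Fin n → B)) (i.compLeft (Fin n)) (p.compLeft (Fin n)) where
  inj x y hxy := funext fun a => h.inj (congrFun hxy a)
  exact x := by
    constructor
    · intro hx
      choose y hy using fun a => (h.exact (x a)).1 (congrFun hx a)
      exact ⟨y, funext hy⟩
    · rintro ⟨y, rfl⟩
      exact funext fun a => (h.exact _).2 ⟨y a, rfl⟩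
  surj x := by
    choose y hy using fun a => h.surj (x a)
    exact ⟨y, funext hy⟩

end Step

/-- There is an exact sequence `0 → A → Q_1 → ⋯ → Q_k → B → 0` with all `Q_i` satisfying `𝒬`. -/
def ExactChain (𝒬 : ModuleCat.{0} R → Prop) : ℕ → ModuleCat.{0} R → ModuleCat.{0} R → Prop
  | 0, A, B => Nonempty (A ≃ₗ[R] B)
  | k + 1, A, B => ∃ (Q M : ModuleCat.{0} R) (i : A →ₗ[R] Q) (p : Q →ₗ[R] M),
      𝒬 Q ∧ IsShortExact i p ∧ ExactChain 𝒬 k M B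

/-- There is an exact sequence `0 → A → Q_1 → ⋯ → Q_k → B → 0` with all `Q_i ∈ add P`. -/
abbrev Shift (P : ModuleCat.{0} R) (k : ℕ) (A B : ModuleCat.{0} R) : Prop :=
  ExactChain (MemAdd P) k A B

theorem ExactChain.mono {𝒬 𝒬' : ModuleCat.{0} R → Prop} (h𝒬 : ∀ Q, 𝒬 Q → 𝒬' Q) {k : ℕ} :
    ∀ {A B : ModuleCat.{0} R}, ExactChain 𝒬 k A B → ExactChain 𝒬' k A B := by
  induction k with
  | zero => exact fun h => h
  | succ k ih =>
    rintro A B ⟨Q, M, i, p, hQ, hs, h⟩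
    exact ⟨Q, M, i, p, h𝒬 Q hQ, hs, ih h⟩

/-- An exact sequence `0 → Y 0 → ⋯ → Y (k + 1) → 0` yields an exact chain. -/
theorem IsExactSeq.exactChain {𝒬 : ModuleCat.{0} R → Prop} {k : ℕ} :
    ∀ {Y : ℕ → ModuleCat.{0} R} {f : ∀ i, Y i →ₗ[R] Y (i + 1)}, IsExactSeq (k + 1) Y f →
      (∀ i, 1 ≤ i → i ≤ k → 𝒬 (Y i)) → ExactChain 𝒬 k (Y 0) (Y (k + 1)) := by
  induction k with
  | zero => exact fun ⟨h1, h2, _⟩ _ => ⟨LinearEquiv.ofBijective _ ⟨h1, h2⟩⟩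
  | succ k ih =>
    intro Y f ⟨h1, h2, h3⟩ h𝒬
    let M : ModuleCat.{0} R := ModuleCat.of R (LinearMap.range (f 1))
    let Y' : ℕ → ModuleCat.{0} R := fun i => match i with
      | 0 => M
      | j + 1 => Y (j + 2)
    let f' : ∀ i : ℕ, Y' i →ₗ[R] Y' (i + 1) := fun i => match i with
      | 0 => (LinearMap.range (f 1)).subtype
      | j + 1 => f (j + 2)
    refine ⟨Y 1, M, f 0, (f 1).rangeRestrict, h𝒬 1 le_rfl (by lia), ⟨h1, ?_, ?_⟩,
      ih (Y := Y') (f := f') ⟨Subtype.val_injective, ?_, fun i hi => ?_⟩ fun i hi hi' => ?_⟩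
    · intro x
      rw [← h3 0 (by lia) x]
      exact Subtype.ext_iff
    · exact LinearMap.surjective_rangeRestrict _
    · cases k with
      | zero => exact fun y => ⟨⟨y, h2 y⟩, rfl⟩
      | succ k => exact h2
    · cases i with
      | zero =>
        intro x
        rw [h3 1 (by lia) x]
        exact ⟨fun hx => ⟨⟨x, hx⟩, rfl⟩, fun ⟨y, hy⟩ => hy ▸ y.2⟩
      | succ i => exact h3 (i + 2) (by lia)
    · cases i with
      | zero => lia
      | succ i => exact h𝒬 (i + 2) (by lia) (by lia)

theorem StableRetract.congr {A A' B B' : ModuleCat.{0} R} (e : A ≃ₗ[R] B) (e' : A' ≃ₗ[R] B')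
    (h : StableRetract P A A') : StableRetract P B B' := by
  obtain ⟨i, p, h⟩ := h
  refine ⟨e'.toLinearMap ∘ₗ i ∘ₗ e.symm.toLinearMap, e.toLinearMap ∘ₗ p ∘ₗ e'.symm.toLinearMap, ?_⟩
  convert (h.comp_left e.toLinearMap).comp_right e.symm.toLinearMap using 1
  ext x
  simp

theorem Shift.stableRetract_iff (hP : ProjInj P) {k : ℕ} :
    ∀ {A B A' B' : ModuleCat.{0} R}, Shift P k A B → Shift P k A' B' →
      (StableRetract P A A' ↔ StableRetract P B B') := by
  induction k with
  | zero =>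
    rintro A B A' B' ⟨e⟩ ⟨e'⟩
    exact ⟨fun h => h.congr e e', fun h => h.congr e.symm e'.symm⟩
  | succ k ih =>
    rintro A B A' B' ⟨Q, M, i, p, hQ, hs, h⟩ ⟨Q', M', i', p', hQ', hs', h'⟩
    exact (hs.stableRetract_iff hs' hP hQ hQ').trans (ih h h')

theorem nonempty_stableEnd_of_stableIso {A B : ModuleCat.{0} R} (a : A →ₗ[R] B) (b : B →ₗ[R] A)
    (hba : Factors P (b ∘ₗ a - LinearMap.id)) (hab : Factors P (a ∘ₗ b - LinearMap.id)) :
    Nonempty (StableEnd P A ≃+* StableEnd P B) := by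
  refine nonempty_ringEquiv_of_subring (Ideal.Quotient.mk _) (Ideal.Quotient.mk _)
    Ideal.Quotient.mk_surjective Ideal.Quotient.mk_surjective
    { carrier := {x : Module.End R A × Module.End R B | Factors P (a ∘ₗ x.1 - x.2 ∘ₗ a)}
      mul_mem' := fun {x y} hx hy => ?_
      one_mem' := ?_
      add_mem' := fun {x y} hx hy => ?_
      zero_mem' := ?_
      neg_mem' := fun {x} hx => ?_ } (fun x => ?_) (fun y => ?_) (fun x hx => ?_)
  · have hx : Factors P (a ∘ₗ x.1 - x.2 ∘ₗ a) := hx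
    have hy : Factors P (a ∘ₗ y.1 - y.2 ∘ₗ a) := hy
    show Factors P (a ∘ₗ (x.1 * y.1) - (x.2 * y.2) ∘ₗ a)
    convert (hx.comp_right y.1).add (hy.comp_left x.2) using 1
    ext z
    simp
  · show Factors P (a ∘ₗ LinearMap.id - LinearMap.id ∘ₗ a)
    rw [LinearMap.comp_id, LinearMap.id_comp, sub_self]
    exact .zero
  · have hx : Factors P (a ∘ₗ x.1 - x.2 ∘ₗ a) := hx
    have hy : Factors P (a ∘ₗ y.1 - y.2 ∘ₗ a) := hy
    show Factors P (a ∘ₗ (x.1 + y.1) - (x.2 + y.2) ∘ₗ a)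
    convert hx.add hy using 1
    ext z
    simp
    abel
  · show Factors P (a ∘ₗ 0 - 0 ∘ₗ a)
    rw [LinearMap.comp_zero, LinearMap.zero_comp, sub_self]
    exact .zero
  · have hx : Factors P (a ∘ₗ x.1 - x.2 ∘ₗ a) := hx
    show Factors P (a ∘ₗ (-x.1) - (-x.2) ∘ₗ a)
    convert hx.neg using 1
    ext z
    simp
    abel
  · refine ⟨a ∘ₗ x ∘ₗ b, ?_⟩
    show Factors P (a ∘ₗ x - (a ∘ₗ x ∘ₗ b) ∘ₗ a)
    convert ((hba.comp_left x).comp_left a).neg using 1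
    ext z
    simp
  · refine ⟨b ∘ₗ y ∘ₗ a, ?_⟩
    show Factors P (a ∘ₗ (b ∘ₗ y ∘ₗ a) - y ∘ₗ a)
    exact (hab.comp_right y).comp_right a
  · rw [StableEnd.mk_eq_zero_iff, StableEnd.mk_eq_zero_iff]
    have hx : Factors P (a ∘ₗ x.1 - x.2 ∘ₗ a) := hx
    constructor
    · intro h
      convert ((h.comp_left a).sub hx).comp_right b |>.sub (hab.comp_left x.2) using 1
      ext z
      simp
    · intro h
      convert ((h.comp_right a).add hx).comp_left b |>.sub (hba.comp_right x.1) using 1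
      ext z
      simp

theorem Shift.nonempty_stableEnd (hP : ProjInj P) {k : ℕ} :
    ∀ {A B : ModuleCat.{0} R}, Shift P k A B → Nonempty (StableEnd P A ≃+* StableEnd P B) := by
  induction k with
  | zero =>
    rintro A B ⟨e⟩
    refine nonempty_stableEnd_of_stableIso e.toLinearMap e.symm.toLinearMap ?_ ?_
    · convert Factors.zero using 1
      ext; simp
    · convert Factors.zero using 1
      ext; simp
  | succ k ih =>
    rintro A B ⟨Q, M, i, p, hQ, hs, h⟩
    obtain ⟨e⟩ := hs.nonempty_stableEnd hP hQ
    obtain ⟨e'⟩ := ih h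
    exact ⟨e.trans e'⟩

theorem Shift.pi (n : ℕ) {k : ℕ} : ∀ {A B : ModuleCat.{0} R}, Shift P k A B →
    Shift P k (ModuleCat.of R (Fin n → A)) (ModuleCat.of R (Fin n → B)) := by
  induction k with
  | zero =>
    rintro A B ⟨e⟩
    exact ⟨LinearEquiv.piCongrRight fun _ => e⟩
  | succ k ih =>
    rintro A B ⟨Q, M, i, p, hQ, hs, h⟩
    exact ⟨_, _, _, _, hQ.pi n, hs.pi n, ih h⟩

theorem Shift.snoc {k : ℕ} : ∀ {A M Q B : ModuleCat.{0} R} {i : M →ₗ[R] Q} {p : Q →ₗ[R] B},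
    Shift P k A M → MemAdd P Q → IsShortExact i p → Shift P (k + 1) A B := by
  induction k with
  | zero =>
    rintro A M Q B i p ⟨e⟩ hQ hs
    refine ⟨Q, B, i ∘ₗ e.toLinearMap, p, hQ, ⟨?_, fun x => ?_, hs.surj⟩,
      ⟨LinearEquiv.refl R B⟩⟩
    · simpa using hs.inj
    · rw [hs.exact x]
      simp [Set.mem_range, e.surjective.exists]
  | succ k ih =>
    rintro A M Q B i p ⟨Q', M', i', p', hQ', hs', h⟩ hQ hs
    exact ⟨Q', M', i', p', hQ', hs', ih h hQ hs⟩

theorem Shift.exists_snoc {k : ℕ} : ∀ {A B : ModuleCat.{0} R}, Shift P (k + 1) A B →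
    ∃ (M Q : ModuleCat.{0} R) (i : M →ₗ[R] Q) (p : Q →ₗ[R] B),
      Shift P k A M ∧ MemAdd P Q ∧ IsShortExact i p := by
  induction k with
  | zero =>
    rintro A B ⟨Q, M, i, p, hQ, hs, ⟨e⟩⟩
    refine ⟨A, Q, i, e.toLinearMap ∘ₗ p, ⟨LinearEquiv.refl R A⟩, hQ, hs.inj, fun x => ?_, ?_⟩
    · rw [← hs.exact x]
      simp
    · simpa using hs.surj
  | succ k ih =>
    rintro A B ⟨Q, M, i, p, hQ, hs, h⟩
    obtain ⟨M', Q', i', p', h', hQ', hs'⟩ := ih h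
    exact ⟨M', Q', i', p', ⟨Q, M, i, p, hQ, hs, h'⟩, hQ', hs'⟩

end Shift

section KrullSchmidt

variable {R : Type} [Ring R] {M N L X : ModuleCat.{0} R}

/-- `M` is nonzero and its endomorphism ring is local. -/
def HasLocalEnd (M : ModuleCat.{0} R) : Prop :=
  Nontrivial M ∧ ∀ f : Module.End R M, IsUnit f ∨ IsUnit (1 - f)

theorem IsSummand.of_isUnit (i : X →ₗ[R] N) (p : N →ₗ[R] X)
    (h : IsUnit (p ∘ₗ i : Module.End R X)) : IsSummand X N := by
  obtain ⟨u, hu⟩ := h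
  refine ⟨i, (u⁻¹ : (Module.End R X)ˣ).val ∘ₗ p, ?_⟩
  rw [LinearMap.comp_assoc, ← hu]
  exact u.inv_mul

theorem IsSummand.exists_prod (h : IsSummand X M) :
    ∃ Y : ModuleCat.{0} R, Nonempty (M ≃ₗ[R] ModuleCat.of R (X × Y)) := by
  obtain ⟨i, p, hp⟩ := h
  have hp : ∀ x, p (i x) = x := LinearMap.congr_fun hp
  refine ⟨ModuleCat.of R (LinearMap.ker p), ⟨LinearEquiv.ofLinearMap
    (p.prod ((LinearMap.id - i ∘ₗ p).codRestrict (LinearMap.ker p) fun m => by simp [hp]))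
    (i.coprod (LinearMap.ker p).subtype) ?_ ?_⟩⟩
  · refine LinearMap.ext fun x => Prod.ext ?_ (Subtype.ext ?_)
    · simp [hp]
    · simp [hp]
  · ext m
    simp

theorem HasLocalEnd.isSummand_prod (hX : HasLocalEnd X)
    (h : IsSummand X (ModuleCat.of R (N × L))) : IsSummand X N ∨ IsSummand X L := by
  obtain ⟨i, p, hp⟩ := h
  have h1 : (1 : Module.End R X) - (p ∘ₗ LinearMap.inl R N L) ∘ₗ (LinearMap.fst R N L ∘ₗ i) =
      (p ∘ₗ LinearMap.inr R N L) ∘ₗ (LinearMap.snd R N L ∘ₗ i) := by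
    rw [sub_eq_iff_eq_add]
    refine hp.symm.trans (LinearMap.ext fun x => ?_)
    simp only [LinearMap.add_apply, LinearMap.comp_apply]
    rw [← map_add]
    congr 1
    refine Prod.ext ?_ ?_ <;> simp
  rcases hX.2 ((p ∘ₗ LinearMap.inl R N L) ∘ₗ (LinearMap.fst R N L ∘ₗ i)) with h | h
  · exact .inl (.of_isUnit _ _ h)
  · rw [h1] at h
    exact .inr (.of_isUnit _ _ h)

theorem HasLocalEnd.isSummand_of_memAdd (hX : HasLocalEnd X) (h : MemAdd N X) :
    IsSummand X N := by
  obtain ⟨n, hn⟩ := h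
  induction n with
  | zero =>
    obtain ⟨i, p, hp⟩ := hn
    obtain ⟨x, y, hxy⟩ := hX.1
    refine absurd ?_ hxy
    rw [← LinearMap.id_apply (R := R) x, ← LinearMap.id_apply (R := R) y, ← hp]
    exact congrArg p (Subsingleton.elim (α := Fin 0 → N) _ _)
  | succ n ih =>
    rcases hX.isSummand_prod (hn.trans (N := ModuleCat.of R (Fin (n + 1) → N))
      (L := ModuleCat.of R (N × ModuleCat.of R (Fin n → N)))
      (IsSummand.of_equiv (Fin.consLinearEquiv R (fun _ : Fin (n + 1) => N)).symm)) with h | h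
    · exact h
    · exact ih h

theorem HasLocalEnd.isSummand_of_prod_of_not_isSummand [IsArtinian R M] (hX : HasLocalEnd X)
    (h : IsSummand M (ModuleCat.of R (X × L))) (hXM : ¬ IsSummand X M) : IsSummand M L := by
  obtain ⟨i, p, hp⟩ := h
  let a : M →ₗ[R] X := LinearMap.fst R X L ∘ₗ i
  let b : X →ₗ[R] M := p ∘ₗ LinearMap.inl R X L
  have hu : IsUnit (1 - a ∘ₗ b : Module.End R X) :=
    (hX.2 (a ∘ₗ b)).resolve_left fun h => hXM (.of_isUnit b a h)
  let c : Module.End R M := (p ∘ₗ LinearMap.inr R X L) ∘ₗ (LinearMap.snd R X L ∘ₗ i)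
  have hc : ∀ m, b (a m) + c m = m := fun m => by
    refine Eq.trans ?_ (LinearMap.congr_fun hp m)
    simp only [a, b, c, LinearMap.comp_apply]
    rw [← map_add]
    congr 1
    refine Prod.ext ?_ ?_ <;> simp
  have hinj : Function.Injective c := by
    rw [← LinearMap.ker_eq_bot, LinearMap.ker_eq_bot']
    intro m hm
    have h1 : b (a m) = m := by simpa [hm] using hc m
    have h2 : a m = 0 := by
      refine ((Module.End.isUnit_iff _).1 hu).injective ?_
      rw [map_zero]
      show a m - a (b (a m)) = 0
      rw [h1, sub_self]
    rw [← h1, h2, map_zero]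
  exact .of_isUnit _ _ ((Module.End.isUnit_iff _).2
    (IsArtinian.bijective_of_injective_endomorphism c hinj))

theorem HasLocalEnd.isSummand_of_pi_prod_of_not_isSummand [IsArtinian R M] (hX : HasLocalEnd X)
    {n : ℕ} (h : IsSummand M (ModuleCat.of R (ModuleCat.of R (Fin n → X) × L)))
    (hXM : ¬ IsSummand X M) : IsSummand M L := by
  induction n with
  | zero =>
    refine h.trans ⟨LinearMap.snd R _ L, LinearMap.inr R _ L,
      LinearMap.ext fun x => Prod.ext ?_ rfl⟩
    exact Subsingleton.elim (α := Fin 0 → X) _ _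
  | succ n ih =>
    refine ih (hX.isSummand_of_prod_of_not_isSummand (h.trans (.of_equiv ?_)) hXM)
    exact ((Fin.consLinearEquiv R (fun _ : Fin (n + 1) => X)).symm.prodCongr
      (LinearEquiv.refl R L)) ≪≫ₗ LinearEquiv.prodAssoc R X (Fin n → X) L

theorem hasLocalEnd_of_isCompl [IsArtinian R M] [IsNoetherian R M] (hM : Nontrivial M)
    (h : ∀ p q : Submodule R M, IsCompl p q → p = ⊥ ∨ q = ⊥) : HasLocalEnd M := by
  refine ⟨hM, fun f => ?_⟩
  obtain ⟨n, hn⟩ := Filter.eventually_atTop.1 (LinearMap.eventually_isCompl_ker_pow_range_pow f)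
  rcases h _ _ (hn (n + 1) n.le_succ) with h | h
  · left
    refine (Module.End.isUnit_iff _).2 (IsArtinian.bijective_of_injective_endomorphism f ?_)
    rw [LinearMap.ker_eq_bot, pow_succ] at h
    exact Function.Injective.of_comp h
  · right
    exact IsNilpotent.isUnit_one_sub ⟨n + 1, LinearMap.range_eq_bot.1 h⟩

theorem exists_isSummand_hasLocalEnd [IsArtinian R M] [IsNoetherian R M] (hM : Nontrivial M) :
    ∃ X : ModuleCat.{0} R, IsSummand X M ∧ HasLocalEnd X := by
  let s : Set ℕ∞ := {l | ∃ X : ModuleCat.{0} R, IsSummand X M ∧ Nontrivial X ∧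
    Module.length R X = l}
  have hs : s.Nonempty := ⟨_, M, IsSummand.refl M, hM, rfl⟩
  obtain ⟨X, hXM, hX, hl⟩ := WellFounded.min_mem (wellFounded_lt (α := ℕ∞)) s hs
  have hXa : IsArtinian R X := by
    obtain ⟨i, p, hp⟩ := hXM
    exact isArtinian_of_injective i (Function.LeftInverse.injective (LinearMap.congr_fun hp))
  have hXn : IsNoetherian R X := by
    obtain ⟨i, p, hp⟩ := hXM
    exact isNoetherian_of_injective i (Function.LeftInverse.injective (LinearMap.congr_fun hp))
  refine ⟨X, hXM, hasLocalEnd_of_isCompl hX fun p q hpq => ?_⟩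
  by_contra! hne
  have hp : Nontrivial p := Submodule.nontrivial_iff_ne_bot.2 hne.1
  have hsum : IsSummand (ModuleCat.of R p) X :=
    (IsSummand.inl (ModuleCat.of R p) (ModuleCat.of R q)).trans
      (.of_equiv (Submodule.prodEquivOfIsCompl p q hpq))
  have hpt : p ≠ ⊤ := fun h => hne.2 (by simpa [h] using hpq.inf_eq_bot)
  refine WellFounded.not_lt_min (wellFounded_lt (α := ℕ∞)) s
    ⟨ModuleCat.of R p, hsum.trans hXM, hp, rfl⟩ ?_
  rw [← hl]
  exact Submodule.length_lt hpt

/-- A basic module of finite length in `add N` is a direct summand of `N`. -/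
theorem IsBasic.isSummand_of_memAdd [IsArtinianRing R] [IsNoetherianRing R]
    (hM : IsBasic M) (hMf : Module.Finite R M) (h : MemAdd N M) : IsSummand M N := by
  induction hl : Module.length R M using WellFoundedLT.induction generalizing M N with
  | ind l ih =>
  subst hl
  rcases subsingleton_or_nontrivial M with hs | hn
  · exact ⟨0, 0, LinearMap.ext fun x => Subsingleton.elim _ _⟩
  obtain ⟨X, hXM, hX⟩ := exists_isSummand_hasLocalEnd hn
  obtain ⟨N', ⟨eN⟩⟩ := (hX.isSummand_of_memAdd (h.of_isSummand hXM)).exists_prod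
  obtain ⟨M', ⟨eM⟩⟩ := hXM.exists_prod
  have hM'M : IsSummand M' M := (IsSummand.inr X M').trans (.of_equiv eM.symm)
  have hM'f : Module.Finite R M' := hM'M.finite
  have hXM' : ¬ IsSummand X M' := fun h' => by
    have := hM X (((IsSummand.refl X).prodMap h').trans (.of_equiv eM.symm))
    exact not_subsingleton_iff_nontrivial.2 hX.1 this
  have hadd : MemAdd N' M' := by
    obtain ⟨n, hn⟩ := h.of_isSummand hM'M
    refine ⟨n, hX.isSummand_of_pi_prod_of_not_isSummand (n := n)
      ((hn.trans ((IsSummand.of_equiv eN).piMap n)).trans ⟨?_, ?_, ?_⟩) hXM'⟩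
    · exact ((LinearMap.fst R X N').compLeft (Fin n)).prod ((LinearMap.snd R X N').compLeft (Fin n))
    · exact ((LinearMap.inl R X N').compLeft (Fin n)).coprod
        ((LinearMap.inr R X N').compLeft (Fin n))
    · refine LinearMap.ext fun x => funext fun a => Prod.ext ?_ ?_ <;> simp
  have hlt : Module.length R M' < Module.length R M := by
    have h1 : Module.length R M = Module.length R X + Module.length R M' :=
      eM.length_eq.trans (Module.length_prod R X M')
    have hX0 : 0 < Module.length R X := Module.length_pos_iff.2 hX.1
    rw [h1]
    exact ENat.lt_add_left Module.length_ne_top hX0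
  have := ih _ hlt (hM.of_isSummand hM'M) hM'f hadd rfl
  exact (IsSummand.of_equiv eM).trans
    (((IsSummand.refl X).prodMap this).trans (.of_equiv eN.symm))

end KrullSchmidt

section Ext

variable {R : Type} [Ring R] {A Q B N M : ModuleCat.{0} R}
  {i : A →ₗ[R] Q} {p : Q →ₗ[R] B}

/-- Vanishing of `Ext^j(M, N)`, in terms of morphisms in the derived category. -/
def ExtVanishes (M N : ModuleCat.{0} R) (j : ℕ) : Prop := ∀ x : Abelian.Ext.{0} M N j, x = 0

theorem ExtZero.extVanishes {j : ℕ} (h : ExtZero M N (j + 1)) : ExtVanishes M N (j + 1) := by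
  let P := projectiveResolution M
  have h1 : Subsingleton ((P.complex.linearYonedaObj ℤ N).homology (j + 1)) :=
    ((P.isoExt (R := ℤ) (j + 1) N).toLinearEquiv.symm).toEquiv.subsingleton_congr.2 h
  have h2 : (P.complex.linearYonedaObj ℤ N).ExactAt (j + 1) := by
    rw [HomologicalComplex.exactAt_iff_isZero_homology]
    exact ModuleCat.isZero_of_subsingleton _
  rw [HomologicalComplex.exactAt_iff' _ j (j + 1) (j + 2) (by simp) (by simp),
    ShortComplex.moduleCat_exact_iff] at h2
  intro x
  obtain ⟨f, hf, rfl⟩ := P.extMk_surjective x (j + 2) rfl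
  rw [P.extMk_eq_zero_iff f (j + 2) rfl hf j rfl]
  exact h2 f hf

theorem ExtVanishes.of_isSummand_left {j : ℕ} (h : ExtVanishes B N j) (hA : IsSummand A B) :
    ExtVanishes A N j := fun x => by
  obtain ⟨i, p, hp⟩ := hA
  have : ModuleCat.ofHom i ≫ ModuleCat.ofHom p = 𝟙 A := ModuleCat.hom_ext hp
  rw [← x.mk₀_id_comp, ← this, ← Abelian.Ext.mk₀_comp_mk₀_assoc,
    h ((Abelian.Ext.mk₀ (ModuleCat.ofHom p)).comp x (zero_add j)), Abelian.Ext.comp_zero]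

theorem ExtVanishes.of_isSummand_right {j : ℕ} (h : ExtVanishes N B j) (hA : IsSummand A B) :
    ExtVanishes N A j := fun x => by
  obtain ⟨i, p, hp⟩ := hA
  have : ModuleCat.ofHom i ≫ ModuleCat.ofHom p = 𝟙 A := ModuleCat.hom_ext hp
  rw [← x.comp_mk₀_id, ← this, ← Abelian.Ext.mk₀_comp_mk₀,
    ← Abelian.Ext.comp_assoc_of_third_deg_zero, h (x.comp _ _), Abelian.Ext.zero_comp]

theorem extVanishes_of_projective (hM : Module.Projective R M) {j : ℕ} (hj : 1 ≤ j) :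
    ExtVanishes M N j := fun x => by
  have := (IsProjective.iff_projective M).1 hM
  exact x.eq_zero_of_hasProjectiveDimensionLT 1 hj

theorem extVanishes_of_injective (hN : Module.Injective R N) {j : ℕ} (hj : 1 ≤ j) :
    ExtVanishes M N j := fun x => by
  have := (Module.injective_iff_injective_object R N).1 hN
  exact x.eq_zero_of_hasInjectiveDimensionLT 1 hj

theorem projective_of_extVanishes (h : ∀ N, ExtVanishes M N 1) : Module.Projective R M :=
  (IsProjective.iff_projective M).2
    (projective_iff_subsingleton_ext_one.2 fun N => subsingleton_of_forall_eq 0 (h N))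

theorem injective_of_extVanishes (h : ∀ M, ExtVanishes M N 1) : Module.Injective R N :=
  (Module.injective_iff_injective_object R N).2
    (injective_iff_subsingleton_ext_one.2 fun M => subsingleton_of_forall_eq 0 (h M))

theorem IsShortExact.shortExact (h : IsShortExact i p) :
    (ShortComplex.mk (ModuleCat.ofHom i) (ModuleCat.ofHom p)
      (ModuleCat.hom_ext h.comp_eq_zero)).ShortExact where
  exact := by
    rw [ShortComplex.moduleCat_exact_iff]
    exact fun x hx => (h.exact x).1 hx
  mono_f := (ModuleCat.mono_iff_injective _).2 h.inj
  epi_g := (ModuleCat.epi_iff_surjective _).2 h.surj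

theorem IsShortExact.extVanishes_left (h : IsShortExact i p) (hQ : Module.Projective R Q) {j : ℕ}
    (hj : 1 ≤ j) (hB : ExtVanishes B N (j + 1)) : ExtVanishes A N j := fun x => by
  obtain ⟨y, rfl⟩ := Abelian.Ext.contravariant_sequence_exact₁ h.shortExact N x (add_comm 1 j)
    (hB _)
  rw [extVanishes_of_projective hQ hj y, Abelian.Ext.comp_zero]

theorem IsShortExact.extVanishes_right (h : IsShortExact i p) (hQ : Module.Projective R Q) {j : ℕ}
    (hA : ExtVanishes A N j) : ExtVanishes B N (j + 1) := fun x => by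
  obtain ⟨y, rfl⟩ := Abelian.Ext.contravariant_sequence_exact₃ h.shortExact N x
    (extVanishes_of_projective hQ (by lia) _) (add_comm 1 j)
  rw [hA y, Abelian.Ext.comp_zero]

theorem IsShortExact.extVanishes_right' (h : IsShortExact i p) (hQ : Module.Injective R Q) {j : ℕ}
    (hj : 1 ≤ j) (hA : ExtVanishes N A (j + 1)) : ExtVanishes N B j := fun x => by
  obtain ⟨y, rfl⟩ := Abelian.Ext.covariant_sequence_exact₃ N h.shortExact x rfl (hA _)
  rw [extVanishes_of_injective hQ hj y, Abelian.Ext.zero_comp]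

theorem IsShortExact.extVanishes_left' (h : IsShortExact i p) (hQ : Module.Injective R Q) {j : ℕ}
    (hB : ExtVanishes N B j) : ExtVanishes N A (j + 1) := fun x => by
  obtain ⟨y, rfl⟩ := Abelian.Ext.covariant_sequence_exact₁ N h.shortExact x
    (extVanishes_of_injective hQ (by lia) _) rfl
  rw [hB y, Abelian.Ext.zero_comp]

theorem IsShortExact.exists_extension (h : IsShortExact i p) (hB : ExtVanishes B N 1)
    (φ : A →ₗ[R] N) : ∃ ψ : Q →ₗ[R] N, ψ ∘ₗ i = φ := by
  obtain ⟨y, hy⟩ := Abelian.Ext.contravariant_sequence_exact₁ h.shortExact N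
    (Abelian.Ext.mk₀ (ModuleCat.ofHom φ)) rfl (hB _)
  obtain ⟨y, rfl⟩ := (Abelian.Ext.mk₀_bijective _ _).2 y
  rw [Abelian.Ext.mk₀_comp_mk₀] at hy
  exact ⟨y.hom, congrArg ModuleCat.Hom.hom ((Abelian.Ext.mk₀_bijective _ _).1 hy)⟩

theorem IsShortExact.exists_lifting (h : IsShortExact i p) (hA : ExtVanishes N A 1)
    (φ : N →ₗ[R] B) : ∃ ψ : N →ₗ[R] Q, p ∘ₗ ψ = φ := by
  obtain ⟨y, hy⟩ := Abelian.Ext.covariant_sequence_exact₃ N h.shortExact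
    (Abelian.Ext.mk₀ (ModuleCat.ofHom φ)) rfl (hA _)
  obtain ⟨y, rfl⟩ := (Abelian.Ext.mk₀_bijective _ _).2 y
  rw [Abelian.Ext.mk₀_comp_mk₀] at hy
  exact ⟨y.hom, congrArg ModuleCat.Hom.hom ((Abelian.Ext.mk₀_bijective _ _).1 hy)⟩

theorem ExactChain.extVanishes_iff {k s : ℕ} (hs : 1 ≤ s) : ∀ {A : ModuleCat.{0} R},
    ExactChain (fun Q => Module.Projective R Q) k A B →
      ((∀ j, s ≤ j → ExtVanishes A N j) ↔ ∀ j, k + s ≤ j → ExtVanishes B N j) := by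
  induction k generalizing s with
  | zero =>
    rintro A ⟨e⟩
    simp only [Nat.zero_add]
    exact ⟨fun h j hj => (h j hj).of_isSummand_left (.of_equiv e.symm),
      fun h j hj => (h j hj).of_isSummand_left (.of_equiv e)⟩
  | succ k ih =>
    rintro A ⟨Q, M, i, p, hQ, hse, h⟩
    rw [Nat.add_right_comm, Nat.add_assoc, ← ih (by lia) h]
    constructor
    · intro hA j hj
      obtain ⟨j, rfl⟩ := Nat.exists_eq_add_of_le' (Nat.le_of_add_left_le hj)
      exact hse.extVanishes_right hQ (hA j (by lia))
    · exact fun hM j hj => hse.extVanishes_left hQ (by lia) (hM (j + 1) (by lia))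

theorem ExactChain.extVanishes_iff' {k s : ℕ} (hs : 1 ≤ s) : ∀ {A : ModuleCat.{0} R},
    ExactChain (fun Q => Module.Injective R Q) k A B →
      ((∀ j, k + s ≤ j → ExtVanishes N A j) ↔ ∀ j, s ≤ j → ExtVanishes N B j) := by
  induction k generalizing s with
  | zero =>
    rintro A ⟨e⟩
    simp only [Nat.zero_add]
    exact ⟨fun h j hj => (h j hj).of_isSummand_right (.of_equiv e.symm),
      fun h j hj => (h j hj).of_isSummand_right (.of_equiv e)⟩
  | succ k ih =>
    rintro A ⟨Q, M, i, p, hQ, hse, h⟩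
    rw [← ih hs h]
    constructor
    · exact fun hA j hj => hse.extVanishes_right' hQ (by lia) (hA (j + 1) (by lia))
    · intro hM j hj
      obtain ⟨j, rfl⟩ := Nat.exists_eq_add_of_le' (show 1 ≤ j by lia)
      exact hse.extVanishes_left' hQ (hM j (by lia))

end Ext

section ExistsShift

variable {R : Type} [Ring R] {P A Q B N M T : ModuleCat.{0} R}
  {i : A →ₗ[R] Q} {p : Q →ₗ[R] B}

theorem IsShortExact.extVanishes_middle (h : IsShortExact i p) {j : ℕ} (hA : ExtVanishes A N j)
    (hB : ExtVanishes B N j) : ExtVanishes Q N j := fun x => by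
  obtain ⟨y, rfl⟩ := Abelian.Ext.contravariant_sequence_exact₂ h.shortExact N x (hA _)
  rw [hB y, Abelian.Ext.comp_zero]

theorem IsShortExact.extVanishes_middle' (h : IsShortExact i p) {j : ℕ} (hA : ExtVanishes N A j)
    (hB : ExtVanishes N B j) : ExtVanishes N Q j := fun x => by
  obtain ⟨y, rfl⟩ := Abelian.Ext.covariant_sequence_exact₂ N h.shortExact x (hB _)
  rw [hA y, Abelian.Ext.zero_comp]

theorem isShortExact_pi_succ (M : ModuleCat.{0} R) (n : ℕ) :
    IsShortExact (A := M) (Q := ModuleCat.of R (Fin (n + 1) → M))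
      (B := ModuleCat.of R (Fin n → M)) (LinearMap.single R (fun _ => M) 0)
      (LinearMap.funLeft R M Fin.succ) where
  inj := Pi.single_injective (M := fun _ : Fin (n + 1) => M) 0
  exact x := by
    constructor
    · intro hx
      refine ⟨x 0, funext fun a => ?_⟩
      refine Fin.cases ?_ (fun a => ?_) a
      · simp
      · simpa using (show x a.succ = 0 from congrFun hx a).symm
    · rintro ⟨y, rfl⟩
      exact funext fun a => Pi.single_eq_of_ne (M := fun _ : Fin (n + 1) => M) a.succ_ne_zero y
  surj := LinearMap.funLeft_surjective_of_injective R M _ (Fin.succ_injective n)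

theorem ExtVanishes.of_memAdd_left {j : ℕ} (h : ExtVanishes M N j) (hA : MemAdd M A) :
    ExtVanishes A N j := by
  obtain ⟨n, hn⟩ := hA
  refine ExtVanishes.of_isSummand_left ?_ hn
  clear hn
  induction n with
  | zero =>
    exact h.of_isSummand_left ⟨0, 0, LinearMap.ext fun x => Subsingleton.elim (α := Fin 0 → M) _ _⟩
  | succ n ih => exact (isShortExact_pi_succ M n).extVanishes_middle h ih

theorem ExtVanishes.of_memAdd_right {j : ℕ} (h : ExtVanishes N M j) (hA : MemAdd M A) :
    ExtVanishes N A j := by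
  obtain ⟨n, hn⟩ := hA
  refine ExtVanishes.of_isSummand_right ?_ hn
  clear hn
  induction n with
  | zero =>
    exact h.of_isSummand_right
      ⟨0, 0, LinearMap.ext fun x => Subsingleton.elim (α := Fin 0 → M) _ _⟩
  | succ n ih => exact (isShortExact_pi_succ M n).extVanishes_middle' h ih

theorem isShortExact_ker (p : Q →ₗ[R] B) (hp : Function.Surjective p) :
    IsShortExact (A := ModuleCat.of R (LinearMap.ker p)) (LinearMap.ker p).subtype p where
  inj := Subtype.val_injective
  exact := LinearMap.exact_subtype_ker_map p
  surj := hp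

theorem isShortExact_range (i : A →ₗ[R] Q) (hi : Function.Injective i) :
    IsShortExact (B := ModuleCat.of R (Q ⧸ LinearMap.range i)) i (LinearMap.range i).mkQ where
  inj := hi
  exact := LinearMap.exact_map_mkQ_range i
  surj := Submodule.mkQ_surjective _

theorem exists_shift_left [IsNoetherianRing R] (hP : ProjInj P) [Module.Finite R P] {k : ℕ}
    (h : Shift P k (reg R) B) {m : ℕ} : ∀ {N : ModuleCat.{0} R}, Module.Finite R N → m ≤ k →
      (∀ j, k < j + m → ExtVanishes B N j) →
        ∃ S : ModuleCat.{0} R, Module.Finite R S ∧ Shift P m S N := by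
  induction m with
  | zero => exact fun {N} hN _ _ => ⟨N, hN, ⟨LinearEquiv.refl R N⟩⟩
  | succ m ih =>
    intro N hN hm hB
    obtain ⟨k, rfl⟩ := Nat.exists_eq_add_of_le' (Nat.le_of_add_left_le hm)
    obtain ⟨Q, M, i, p, hQ, hs, hMB⟩ := h
    have hM : ∀ j, 1 ≤ j → ExtVanishes M N j :=
      (ExactChain.extVanishes_iff le_rfl (hMB.mono fun Q hQ => hQ.projective hP.1)).2
        fun j hj => hB j (by lia)
    obtain ⟨n, g, hg⟩ := Module.Finite.exists_fin (R := R) (M := N)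
    choose ψ hψ using fun a : Fin n => hs.exists_extension (hM 1 le_rfl)
      (LinearMap.toSpanSingleton R N (g a))
    let π : ModuleCat.of R (Fin n → Q) →ₗ[R] N := LinearMap.lsum R (fun _ => Q) ℕ ψ
    have hπ : Function.Surjective π := by
      rw [← LinearMap.range_eq_top, eq_top_iff, ← hg, Submodule.span_le]
      rintro _ ⟨a, rfl⟩
      refine ⟨Pi.single a (i (1 : R)), ?_⟩
      have h1 : ψ a (i (1 : R)) = g a :=
        (LinearMap.congr_fun (hψ a) (1 : R)).trans (one_smul R (g a))
      have h2 : LinearMap.lsum R (fun _ => Q) ℕ ψ (Pi.single a (i (1 : R))) = ψ a (i (1 : R)) :=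
        LinearMap.lsum_piSingle ..
      exact h2.trans h1
    have hQn : MemAdd P (ModuleCat.of R (Fin n → Q)) := hQ.pi n
    have hQf : Module.Finite R (ModuleCat.of R (Fin n → Q)) := hQn.finite
    have hs' := isShortExact_ker π hπ
    obtain ⟨S, hS, hS'⟩ := ih (N := ModuleCat.of R (LinearMap.ker π))
      (inferInstanceAs (Module.Finite R (LinearMap.ker π))) (by lia) fun j hj => by
        obtain ⟨j, rfl⟩ := Nat.exists_eq_add_of_le' (show 1 ≤ j by lia)
        exact hs'.extVanishes_left' (hQn.injective hP.2) (hB j (by lia))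
    exact ⟨S, hS, hS'.snoc hQn hs'⟩

theorem exists_shift_right (hP : ProjInj P) [Module.Finite R P] {k : ℕ}
    (hB : ∀ N : ModuleCat.{0} R, Module.Finite R N →
      ∃ (n : ℕ) (φ : N →ₗ[R] (Fin n → B)), Function.Injective φ)
    (h : Shift P k A B) {m : ℕ} : ∀ {N : ModuleCat.{0} R}, Module.Finite R N → m ≤ k →
      (∀ j, k < j + m → ExtVanishes N A j) →
        ∃ S : ModuleCat.{0} R, Module.Finite R S ∧ Shift P m N S := by
  induction m with
  | zero => exact fun {N} hN _ _ => ⟨N, hN, ⟨LinearEquiv.refl R N⟩⟩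
  | succ m ih =>
    intro N hN hm hA
    obtain ⟨k, rfl⟩ := Nat.exists_eq_add_of_le' (Nat.le_of_add_left_le hm)
    obtain ⟨M, Q, i, p, hAM, hQ, hs⟩ := h.exists_snoc
    have hM : ∀ j, 1 ≤ j → ExtVanishes N M j :=
      (ExactChain.extVanishes_iff' le_rfl (hAM.mono fun Q hQ => hQ.injective hP.2)).1
        fun j hj => hA j (by lia)
    obtain ⟨n, φ, hφ⟩ := hB N hN
    choose ψ hψ using fun a : Fin n => hs.exists_lifting (hM 1 le_rfl) (LinearMap.proj a ∘ₗ φ)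
    let ι : N →ₗ[R] ModuleCat.of R (Fin n → Q) := LinearMap.pi ψ
    have hι : Function.Injective ι := fun x y hxy => hφ (funext fun a => by
      rw [show φ x a = p (ψ a x) from (LinearMap.congr_fun (hψ a) x).symm,
        show φ y a = p (ψ a y) from (LinearMap.congr_fun (hψ a) y).symm]
      exact congrArg p (congrFun hxy a))
    have hQn : MemAdd P (ModuleCat.of R (Fin n → Q)) := hQ.pi n
    have hQf : Module.Finite R (ModuleCat.of R (Fin n → Q)) := hQn.finite
    have hs' := isShortExact_range ι hι
    obtain ⟨S, hS, hS'⟩ := ih (N := ModuleCat.of R (_ ⧸ LinearMap.range ι))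
      (inferInstanceAs (Module.Finite R (_ ⧸ LinearMap.range ι))) (by lia) fun j hj => by
        obtain ⟨j, rfl⟩ := Nat.exists_eq_add_of_le' (show 1 ≤ j by lia)
        exact hs'.extVanishes_right (hQn.projective hP.1) (hA j (by lia))
    exact ⟨S, hS, _, _, _, _, hQn, hs', hS'⟩

theorem PdimLE.extVanishes {k : ℕ} (h : PdimLE k M) {j : ℕ} (hj : k + 1 ≤ j) :
    ExtVanishes M N j := by
  obtain ⟨Y, f, hY, hp, rfl⟩ := h
  exact (ExactChain.extVanishes_iff le_rfl (hY.exactChain fun i _ hi => hp i hi)).1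
    (fun j hj => extVanishes_of_projective (hp 0 (Nat.zero_le k)) hj) j hj

theorem IdimLE.extVanishes {k : ℕ} (h : IdimLE k M) {j : ℕ} (hj : k + 1 ≤ j) :
    ExtVanishes N M j := by
  obtain ⟨Y, f, hY, hp, rfl⟩ := h
  exact (ExactChain.extVanishes_iff' le_rfl
    (hY.exactChain fun i h1 hi => hp i h1 (Nat.le_succ_of_le hi))).2
    (fun j hj => extVanishes_of_injective (hp (k + 1) (by lia) le_rfl) hj) j hj

theorem ExtVanishing.extVanishes (h : ExtVanishing M N) {j : ℕ} (hj : 1 ≤ j) :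
    ExtVanishes M N j := by
  obtain ⟨j, rfl⟩ := Nat.exists_eq_add_of_le' hj
  exact ExtZero.extVanishes (h _ hj)

theorem exists_projective_shift [IsNoetherianRing R] (hP : ProjInj P) [Module.Finite R P]
    [Module.Finite R T] {k : ℕ} (hT : ExtVanishing T T) (hpd : PdimLE k T) (hBT : MemAdd T B)
    (h : Shift P k (reg R) B) :
    ∃ S : ModuleCat.{0} R, Module.Finite R S ∧ Module.Projective R S ∧ Shift P k S T := by
  obtain ⟨S, hS, hST⟩ := exists_shift_left hP h (N := T) inferInstance le_rfl
    fun j hj => (hT.extVanishes (by lia)).of_memAdd_left hBT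
  refine ⟨S, hS, projective_of_extVanishes fun N => ?_, hST⟩
  exact (ExactChain.extVanishes_iff le_rfl (hST.mono fun Q hQ => hQ.projective hP.1)).2
    (fun j hj => hpd.extVanishes hj) 1 le_rfl

theorem exists_injective_shift (hP : ProjInj P) [Module.Finite R P] [Module.Finite R T]
    (hB : ∀ N : ModuleCat.{0} R, Module.Finite R N →
      ∃ (n : ℕ) (φ : N →ₗ[R] (Fin n → B)), Function.Injective φ)
    {k : ℕ} (hT : ExtVanishing T T) (hid : IdimLE k T) (hAT : MemAdd T A) (h : Shift P k A B) :
    ∃ S : ModuleCat.{0} R, Module.Finite R S ∧ Module.Injective R S ∧ Shift P k T S := by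
  obtain ⟨S, hS, hTS⟩ := exists_shift_right hP hB h (N := T) inferInstance le_rfl
    fun j hj => (hT.extVanishes (by lia)).of_memAdd_right hAT
  refine ⟨S, hS, injective_of_extVanishes fun N => ?_, hTS⟩
  exact (ExactChain.extVanishes_iff' le_rfl (hTS.mono fun Q hQ => hQ.injective hP.2)).1
    (fun j hj => hid.extVanishes hj) 1 le_rfl

end ExistsShift

section Comparison

variable {R : Type} [Ring R] {P G T S t : ModuleCat.{0} R}

theorem finite_end (K : Type) [Field K] [Algebra K R] [FiniteDimensional K R]
    (M : ModuleCat.{0} R) [Module.Finite R M] : Module.Finite K (Module.End R M) := by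
  let := kMod K M
  have : IsScalarTower K R M := ⟨fun c r m => by
    rw [Algebra.smul_def, mul_smul]
    rfl⟩
  have : Module.Finite K M := Module.Finite.trans R M
  let f : Module.End R M →ₗ[K] (M →ₗ[K] M) :=
    { toFun := fun φ => φ.restrictScalars K
      map_add' := fun _ _ => rfl
      map_smul' := fun _ _ => rfl }
  exact Module.Finite.of_injective f fun φ ψ h =>
    LinearMap.ext fun x => LinearMap.congr_fun h x

theorem nonempty_stableEnd_of_stableRetract [IsArtinianRing (Module.End R S)]
    (h : StableRetract P S G) (h' : StableRetract P G S) :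
    Nonempty (StableEnd P S ≃+* StableEnd P G) := by
  obtain ⟨a, b, hba⟩ := h
  obtain ⟨c, d, hdc⟩ := h'
  have : IsArtinianRing (StableEnd P S) :=
    Function.Surjective.isArtinianRing (Ideal.Quotient.mk_surjective (I := factorsIdeal P S))
  let q := Ideal.Quotient.mk (factorsIdeal P S)
  have h1 : q (b ∘ₗ d) * q (c ∘ₗ a) = 1 := by
    rw [← map_mul, ← map_one q, ← sub_eq_zero, ← map_sub, StableEnd.mk_eq_zero_iff]
    convert ((hdc.comp_right a).comp_left b).add hba using 1
    ext x
    simp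
  have h2 := mul_eq_one_symm h1
  rw [← map_mul, ← map_one q, ← sub_eq_zero, ← map_sub, StableEnd.mk_eq_zero_iff] at h2
  refine nonempty_stableEnd_of_stableIso d c ?_ hdc
  convert (((hdc.comp_right (a ∘ₗ b ∘ₗ d)).comp_left c).sub
    (h2.comp_left (c ∘ₗ d))).add h2 using 1
  ext x
  simp

theorem nonempty_stableEnd_of_isBasic (K : Type) [Field K] [Algebra K R] [FiniteDimensional K R]
    [Module.Finite R G] [Module.Finite R T] [Module.Finite R S] (hG : IsBasic G) (hT : IsBasic T)
    (hS : MemAdd G S) (ht : MemAdd T t)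
    (hST : ∀ n, StableRetract P S (ModuleCat.of R (Fin n → G)) →
      StableRetract P T (ModuleCat.of R (Fin n → t)))
    (htG : ∀ n, StableRetract P t (ModuleCat.of R (Fin n → T)) →
      StableRetract P G (ModuleCat.of R (Fin n → S)))
    (hTS : StableRetract P T t → StableRetract P S G) :
    Nonempty (StableEnd P S ≃+* StableEnd P G) := by
  have : IsArtinianRing R := .of_finite K R
  have : IsNoetherianRing R := .of_finite K R
  have := finite_end K S
  have : IsArtinianRing (Module.End R S) := .of_finite K _
  obtain ⟨n, hn⟩ := hS
  obtain ⟨m, hm⟩ := ht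
  refine nonempty_stableEnd_of_stableRetract (hTS ?_) ?_
  · exact .of_isSummand_prod (hT.isSummand_of_memAdd inferInstance
      (hST n hn.stableRetract).memAdd)
  · exact .of_isSummand_prod (hG.isSummand_of_memAdd inferInstance
      (htG m hm.stableRetract).memAdd)

end Comparison

section Basic

variable {R R' : Type} [Ring R] [Ring R'] {M : ModuleCat.{0} R} {N : ModuleCat.{0} R'}

theorem isBasic_iff : IsBasic M ↔ ∀ u v : Module.End R M,
    u * v * u = u → v * u * v = v → u * u = 0 → v * v = 0 → u = 0 := by
  constructor
  · intro h u v huvu _ hu hv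
    have h1 (x : M) : u (v (u x)) = u x := LinearMap.congr_fun huvu x
    have h3 (x : M) : u (u x) = 0 := LinearMap.congr_fun hu x
    have h4 (x : M) : v (v x) = 0 := LinearMap.congr_fun hv x
    let X := LinearMap.range (u * v)
    have hX (x : X) : u (v x) = x := by
      obtain ⟨_, y, rfl⟩ := x
      exact h1 (v y)
    have := h (ModuleCat.of R X) ⟨X.subtype.coprod (v ∘ₗ X.subtype),
      (u * v).rangeRestrict.prod (u.codRestrict X fun x => ⟨u x, h1 x⟩),
      LinearMap.ext fun ⟨x, y⟩ => Prod.ext (Subtype.ext ?_) (Subtype.ext ?_)⟩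
    · ext x
      have h5 : (⟨u x, u x, h1 x⟩ : X) = 0 := Subsingleton.elim (α := X) _ _
      exact congrArg Subtype.val h5
    · change u (v (x + v y)) = x
      rw [map_add, map_add, h4, map_zero, add_zero, hX]
    · change u (x + v y) = y
      rw [map_add, hX, ← hX x, h3, zero_add]
  · rintro h X ⟨i, p, hp⟩
    have hp' (x : X × X) : p (i x) = x := LinearMap.congr_fun hp x
    have hi : i ((0, 0) : X × X) = 0 := map_zero i
    let α : X × X →ₗ[R] X × X := (LinearMap.snd R X X).prod 0
    let β : X × X →ₗ[R] X × X := LinearMap.prod 0 (LinearMap.fst R X X)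
    have h0 := h (i ∘ₗ α ∘ₗ p) (i ∘ₗ β ∘ₗ p) (LinearMap.ext fun x => by simp [hp', α, β])
      (LinearMap.ext fun x => by simp [hp', α, β]) (LinearMap.ext fun x => by simp [hp', hi, α])
      (LinearMap.ext fun x => by simp [hp', hi, β])
    refine subsingleton_of_forall_eq 0 fun x => ?_
    have h1 := congrArg p (LinearMap.congr_fun h0 (i (0, x)))
    simpa [hp', α] using congrArg Prod.fst h1

theorem IsBasic.of_ringEquiv (hM : IsBasic M) (e : Module.End R M ≃+* Module.End R' N) :
    IsBasic N := by
  rw [isBasic_iff] at hM ⊢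
  intro u v h1 h2 h3 h4
  have := hM (e.symm u) (e.symm v) (by simp only [← map_mul, h1]) (by simp only [← map_mul, h2])
    (by simp only [← map_mul, h3, map_zero]) (by simp only [← map_mul, h4, map_zero])
  simpa using this

end Basic

section Quotient

variable {R : Type} [Ring R] {P M : ModuleCat.{0} R}

theorem nonempty_ringQuot_ringEquiv {A E : Type} [Ring A] [Ring E] {a₀ : A} (q : A →+* E)
    (hq : Function.Surjective q) (h₀ : q a₀ = 0)
    (h : ∀ a, q a = 0 → RingQuot.mkRingHom (fun x y : A => x = a₀ ∧ y = 0) a = 0) :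
    Nonempty (RingQuot (fun x y : A => x = a₀ ∧ y = 0) ≃+* E) := by
  let l : RingQuot (fun x y : A => x = a₀ ∧ y = 0) →+* E :=
    RingQuot.lift ⟨q, by rintro x y ⟨rfl, rfl⟩; rw [h₀, map_zero]⟩
  have hl (a : A) : l (RingQuot.mkRingHom _ a) = q a := RingQuot.lift_mkRingHom_apply ..
  refine ⟨RingEquiv.ofBijective l ⟨(injective_iff_map_eq_zero l).2 fun x hx => ?_, fun y => ?_⟩⟩
  · obtain ⟨a, rfl⟩ := RingQuot.mkRingHom_surjective _ x
    exact h a (hl a ▸ hx)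
  · obtain ⟨a, rfl⟩ := hq y
    exact ⟨_, hl a⟩

theorem Factors.exists_sum {f φ : Module.End R M} (hf : IsIdempotentElem f)
    (e : (ModuleCat.of R (LinearMap.range f)) ≃ₗ[R] P) (h : Factors P φ) :
    ∃ (n : ℕ) (α β : Fin n → Module.End R M), φ = ∑ i, α i * f * β i := by
  obtain ⟨Q, ⟨n, ι, π, hπ⟩, g, h, rfl⟩ := h
  refine ⟨n, fun i => h ∘ₗ π ∘ₗ LinearMap.single R (fun _ => P) i ∘ₗ e.toLinearMap ∘ₗ
    f.rangeRestrict, fun i => (LinearMap.range f).subtype ∘ₗ e.symm.toLinearMap ∘ₗ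
    LinearMap.proj i ∘ₗ ι ∘ₗ g, LinearMap.ext fun x => ?_⟩
  have hfe (z : P) : f.rangeRestrict (f (e.symm z : LinearMap.range f)) = e.symm z := by
    have h1 : ∀ y : LinearMap.range f, f.rangeRestrict (f y) = y := by
      rintro ⟨_, y, rfl⟩
      have h2 := LinearMap.congr_fun hf.eq
      refine Subtype.ext ?_
      change f (f (f y)) = f y
      exact (h2 (f y)).trans (h2 y)
    exact h1 _
  have h3 : π (ι (g x)) = g x := LinearMap.congr_fun hπ (g x)
  rw [LinearMap.sum_apply]
  have h4 (i : Fin n) : e (f.rangeRestrict (f (e.symm (ι (g x) i) : LinearMap.range f))) =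
      ι (g x) i := by
    rw [hfe]
    exact e.apply_symm_apply _
  change h (g x) = ∑ i, h (π (Pi.single i (e (f.rangeRestrict (f
    (e.symm (ι (g x) i) : LinearMap.range f))))))
  simp only [h4]
  rw [← map_sum, ← map_sum, Finset.univ_sum_single, h3]

theorem nonempty_ringQuot_stableEnd {A : Type} [Ring A] (ε : A ≃+* (Module.End R M)ᵐᵒᵖ) {a₀ : A}
    (ha₀ : IsIdempotentElem a₀)
    (he : Nonempty ((ModuleCat.of R (LinearMap.range (ε a₀).unop)) ≃ₗ[R] P)) :
    Nonempty (RingQuot (fun x y : A => x = a₀ ∧ y = 0) ≃+* (StableEnd P M)ᵐᵒᵖ) := by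
  obtain ⟨e⟩ := he
  have hf : IsIdempotentElem (ε a₀).unop := by
    rw [IsIdempotentElem, ← MulOpposite.unop_mul, ← map_mul, ha₀.eq]
  have hq (a : A) : (Ideal.Quotient.mk (factorsIdeal P M)).op (ε a) = 0 ↔
      Factors P (ε a).unop := by
    rw [← StableEnd.mk_eq_zero_iff (P := P)]
    exact MulOpposite.unop_injective.eq_iff.symm
  refine nonempty_ringQuot_ringEquiv
    ((Ideal.Quotient.mk (factorsIdeal P M)).op.comp ε.toRingHom) ?_ ?_ ?_
  · intro y
    obtain ⟨φ, hφ⟩ := Ideal.Quotient.mk_surjective y.unop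
    refine ⟨ε.symm (MulOpposite.op φ), ?_⟩
    change (Ideal.Quotient.mk (factorsIdeal P M)).op (ε (ε.symm (MulOpposite.op φ))) = y
    rw [ε.apply_symm_apply]
    exact MulOpposite.unop_injective hφ
  · refine (hq a₀).2 ⟨_, (IsSummand.of_equiv e).memAdd, (ε a₀).unop.rangeRestrict,
      (LinearMap.range (ε a₀).unop).subtype, rfl⟩
  · intro a ha
    obtain ⟨n, α, β, hn⟩ := ((hq a).1 ha).exists_sum hf e
    have ha : a = ∑ i, ε.symm (MulOpposite.op (β i)) * a₀ * ε.symm (MulOpposite.op (α i)) := by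
      apply ε.injective
      apply MulOpposite.unop_injective
      rw [hn]
      simp [Finset.unop_sum, mul_assoc]
    have h0 : RingQuot.mkRingHom (fun x y : A => x = a₀ ∧ y = 0) a₀ = 0 :=
      (RingQuot.mkRingHom_rel ⟨rfl, rfl⟩).trans (map_zero _)
    rw [ha, map_sum]
    exact Finset.sum_eq_zero fun i _ => by rw [map_mul, map_mul, h0, mul_zero, zero_mul]

end Quotient

section DualRegular

variable {K : Type} [Field K] {R : Type} [Ring R] [Algebra K R]

/-- The elements of `D R` are the linear forms on `R`. -/
def dregForm : Dreg K R ≃+ (R →ₗ[K] K) := AddEquiv.refl (R →ₗ[K] K)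

theorem dreg_ext {φ ψ : Dreg K R} (h : ∀ x, dregForm φ x = dregForm ψ x) : φ = ψ :=
  dregForm.injective (LinearMap.ext h)

theorem dregForm_smul (s : R) (φ : Dreg K R) (x : R) :
    dregForm (s • φ) x = dregForm φ (x * s) := rfl

theorem dregForm_symm_smul (c : K) (φ : R →ₗ[K] K) :
    dregForm.symm (c • φ) = algebraMap K R c • dregForm.symm φ := dreg_ext fun x => by
  rw [dregForm_smul, ← Algebra.commutes, ← Algebra.smul_def, AddEquiv.apply_symm_apply,
    AddEquiv.apply_symm_apply, map_smul, LinearMap.smul_apply]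

/-- The right multiplications by elements of `R`, acting on `D R` by precomposition with left
multiplications. -/
def dregEndHom : Rᵐᵒᵖ →+* Module.End R (Dreg K R) where
  toFun γ :=
    { toFun := fun φ => dregForm.symm (dregForm φ ∘ₗ LinearMap.mulLeft K γ.unop)
      map_add' := fun _ _ => rfl
      map_smul' := fun s φ => dreg_ext fun x => congrArg (dregForm φ) (mul_assoc γ.unop x s) }
  map_one' := LinearMap.ext fun φ => dreg_ext fun x => congrArg (dregForm φ) (one_mul x)
  map_mul' a b := LinearMap.ext fun φ => dreg_ext fun x =>
    congrArg (dregForm φ) (mul_assoc b.unop a.unop x)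
  map_zero' := LinearMap.ext fun φ => dreg_ext fun x =>
    (congrArg (dregForm φ) (zero_mul x)).trans (map_zero (dregForm φ))
  map_add' a b := LinearMap.ext fun φ => dreg_ext fun x =>
    (congrArg (dregForm φ) (add_mul a.unop b.unop x)).trans (map_add (dregForm φ) _ _)

theorem dregForm_dregEndHom (γ : Rᵐᵒᵖ) (φ : Dreg K R) (x : R) :
    dregForm (dregEndHom γ φ) x = dregForm φ (γ.unop * x) := rfl

variable [FiniteDimensional K R]

theorem dregEndHom_bijective : Function.Bijective (dregEndHom (K := K) (R := R)) := by
  constructor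
  · refine (injective_iff_map_eq_zero _).2 fun γ hγ => MulOpposite.unop_injective ?_
    refine (Module.forall_dual_apply_eq_zero_iff K γ.unop).1 fun φ => ?_
    have h1 := dregForm_dregEndHom γ (dregForm.symm φ) 1
    rw [hγ, LinearMap.zero_apply, map_zero, LinearMap.zero_apply, mul_one,
      AddEquiv.apply_symm_apply] at h1
    exact h1.symm
  · intro f
    let F : Module.Dual K (Module.Dual K R) :=
      { toFun := fun φ => dregForm (f (dregForm.symm φ)) 1
        map_add' := fun φ ψ => by
          rw [map_add, map_add, map_add, LinearMap.add_apply]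
        map_smul' := fun c φ => by
          rw [dregForm_symm_smul, map_smul, dregForm_smul, one_mul,
            Algebra.algebraMap_eq_smul_one, map_smul, RingHom.id_apply] }
    obtain ⟨γ, hγ⟩ := (Module.bijective_dual_eval K R).2 F
    refine ⟨MulOpposite.op γ, LinearMap.ext fun φ => dreg_ext fun x => ?_⟩
    have h1 : dregForm (x • φ) γ = dregForm (f (x • φ)) 1 :=
      LinearMap.congr_fun hγ (dregForm (x • φ))
    rw [map_smul f, dregForm_smul, dregForm_smul, one_mul] at h1
    exact h1

variable (K R) in
/-- The endomorphism ring of `D R` is the opposite of `R`. -/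
def dregEndEquiv : Rᵐᵒᵖ ≃+* Module.End R (Dreg K R) :=
  RingEquiv.ofBijective dregEndHom dregEndHom_bijective

theorem isBasic_Dreg (h : IsBasic (reg R)) : IsBasic (Dreg K R) :=
  h.of_ringEquiv ((RingEquiv.moduleEndSelf R).symm.trans (dregEndEquiv K R))

variable (K R) in
theorem finite_Dreg : Module.Finite R (Dreg K R) := by
  let : Module K (Dreg K R) := inferInstanceAs (Module K (R →ₗ[K] K))
  have : IsScalarTower K R (Dreg K R) := ⟨fun c s φ => dreg_ext fun x => by
    rw [dregForm_smul, mul_smul_comm, map_smul]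
    rfl⟩
  have : Module.Finite K (Dreg K R) := inferInstanceAs (Module.Finite K (R →ₗ[K] K))
  exact Module.Finite.of_restrictScalars_finite K R _

variable (K) in
theorem exists_injective_pi_Dreg (N : ModuleCat.{0} R) (hN : Module.Finite R N) :
    ∃ (n : ℕ) (φ : N →ₗ[R] (Fin n → Dreg K R)), Function.Injective φ := by
  let := kMod K N
  have : IsScalarTower K R N := ⟨fun c r m => by
    rw [Algebra.smul_def, mul_smul]
    rfl⟩
  have : Module.Finite K N := Module.Finite.trans R N
  let b := Module.finBasis K N
  refine ⟨_, LinearMap.pi fun i =>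
    { toFun := fun m =>
        dregForm.symm (b.coord i ∘ₗ (LinearMap.toSpanSingleton R N m).restrictScalars K)
      map_add' := fun m m' => dreg_ext fun x =>
        (congrArg (b.coord i) (smul_add x m m')).trans (map_add _ _ _)
      map_smul' := fun s m => dreg_ext fun x => congrArg (b.coord i) (mul_smul x s m).symm },
    fun m m' h => b.ext_elem fun i => ?_⟩
  have h1 : b.coord i ((1 : R) • m) = b.coord i ((1 : R) • m') :=
    congrArg (fun χ => dregForm χ 1) (congrFun h i)
  simpa using h1

theorem memAdd_Dreg {S : ModuleCat.{0} R} (hS : Module.Finite R S) (hi : Module.Injective R S) :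
    MemAdd (Dreg K R) S := by
  obtain ⟨n, φ, hφ⟩ := exists_injective_pi_Dreg K S hS
  obtain ⟨ψ, hψ⟩ := hi.out φ hφ LinearMap.id
  exact ⟨n, φ, ψ, LinearMap.ext hψ⟩

end DualRegular

section DualModule

variable {K : Type} [Field K] {R : Type} [Ring R] [Algebra K R] {X : ModuleCat.{0} R}

/-- Evaluation of an element of `D X`, as an additive map. -/
def dmodEval : Dmod K X →+ X →+ K :=
  letI := kMod K X
  { toFun := fun χ => (show X →ₗ[K] K from χ).toAddMonoidHom
    map_zero' := rfl
    map_add' := fun _ _ => rfl }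

theorem dmodEval_smul (s : Rᵐᵒᵖ) (χ : Dmod K X) (x : X) :
    dmodEval (s • χ) x = dmodEval χ (s.unop • x) := rfl

theorem dmodEval_algebraMap_smul (c : K) (χ : Dmod K X) (x : X) :
    dmodEval χ (algebraMap K R c • x) = c * dmodEval χ x :=
  letI := kMod K X
  map_smul (show X →ₗ[K] K from χ) c x

theorem eq_zero_of_dmodEval {x : X} (h : ∀ χ : Dmod K X, dmodEval χ x = 0) : x = 0 :=
  letI := kMod K X
  (Module.forall_dual_apply_eq_zero_iff K x).1 h

theorem exists_dmodEval [FiniteDimensional K R] [Module.Finite R X] (F : Dmod K X →+ K)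
    (hF : ∀ (c : K) χ, F (MulOpposite.op (algebraMap K R c) • χ) = c * F χ) :
    ∃ x, ∀ χ, F χ = dmodEval χ x := by
  let := kMod K X
  have : IsScalarTower K R X := ⟨fun c r m => by
    rw [Algebra.smul_def, mul_smul]
    rfl⟩
  have : Module.Finite K X := Module.Finite.trans R X
  let G : Module.Dual K (Module.Dual K X) :=
    { toFun := F
      map_add' := map_add F
      map_smul' := fun c χ => by
        have : (c • χ : Module.Dual K X) =
            (show Module.Dual K X from MulOpposite.op (algebraMap K R c) • (show Dmod K X from χ)) :=
          LinearMap.ext fun x => (dmodEval_algebraMap_smul c χ x).symm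
        rw [this]
        exact hF c χ }
  obtain ⟨x, hx⟩ := (Module.bijective_dual_eval K X).2 G
  exact ⟨x, fun χ => (LinearMap.congr_fun hx χ).symm⟩

theorem nonempty_range_dregEndHom [FiniteDimensional K R] [Module.Finite R X] {e : R}
    (he : IsIdempotentElem e)
    (σ : (ModuleCat.of Rᵐᵒᵖ (Submodule.span Rᵐᵒᵖ ({e} : Set R))) ≃ₗ[Rᵐᵒᵖ] Dmod K X) :
    Nonempty ((ModuleCat.of R (LinearMap.range (dregEndHom (K := K) (MulOpposite.op e))))
      ≃ₗ[R] X) := by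
  let g : Submodule.span Rᵐᵒᵖ ({e} : Set R) := ⟨e, Submodule.mem_span_singleton_self e⟩
  have hg (y : Submodule.span Rᵐᵒᵖ ({e} : Set R)) : ∃ x : R, MulOpposite.op x • g = y := by
    obtain ⟨x, hx⟩ := Submodule.mem_span_singleton.1 y.2
    exact ⟨x.unop, Subtype.ext hx⟩
  have hge (x : R) : MulOpposite.op (e * x) • g = MulOpposite.op x • g :=
    Subtype.ext (show e * (e * x) = e * x by rw [← mul_assoc, he.eq])
  let τ : Submodule.span Rᵐᵒᵖ ({e} : Set R) →ₗ[Rᵐᵒᵖ] Dmod K X := σ.toLinearMap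
  let ψ : X →ₗ[R] Dreg K R :=
    { toFun := fun m => dregForm.symm
        { toFun := fun x => dmodEval (τ (MulOpposite.op x • g)) m
          map_add' := fun x y => by
            rw [MulOpposite.op_add, add_smul, map_add, map_add, AddMonoidHom.add_apply]
          map_smul' := fun c x => by
            rw [Algebra.smul_def, Algebra.commutes, MulOpposite.op_mul, mul_smul, map_smul,
              dmodEval_smul]
            exact dmodEval_algebraMap_smul c _ m }
      map_add' := fun m m' => dreg_ext fun x => map_add (dmodEval (τ (MulOpposite.op x • g))) m m'
      map_smul' := fun s m => dreg_ext fun x => by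
        change dmodEval (τ (MulOpposite.op x • g)) (s • m) =
          dmodEval (τ (MulOpposite.op (x * s) • g)) m
        rw [MulOpposite.op_mul, mul_smul, map_smul τ (MulOpposite.op s)]
        rfl }
  have hψ (m : X) (x : R) : dregForm (ψ m) x = dmodEval (τ (MulOpposite.op x • g)) m := rfl
  have hinj : Function.Injective ψ := by
    refine (injective_iff_map_eq_zero ψ).2 fun m hm => eq_zero_of_dmodEval (K := K) fun χ => ?_
    obtain ⟨x, hx⟩ := hg (σ.symm χ)
    have h1 : τ (MulOpposite.op x • g) = χ := by
      rw [hx]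
      exact σ.apply_symm_apply χ
    rw [← h1, ← hψ, hm, map_zero, LinearMap.zero_apply]
  have hrange : LinearMap.range ψ = LinearMap.range (dregEndHom (K := K) (MulOpposite.op e)) := by
    apply le_antisymm
    · rintro _ ⟨m, rfl⟩
      refine ⟨ψ m, dreg_ext fun x => ?_⟩
      rw [dregForm_dregEndHom, hψ, hψ, MulOpposite.unop_op, hge]
    · rintro _ ⟨φ, rfl⟩
      obtain ⟨m, hm⟩ := exists_dmodEval (K := K) (X := X)
        ((dregForm φ).toAddMonoidHom.comp ((Submodule.subtype _).toAddMonoidHom.comp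
          σ.symm.toLinearMap.toAddMonoidHom)) fun c χ => by
            change dregForm φ (σ.symm (MulOpposite.op (algebraMap K R c) • χ) :
              Submodule.span Rᵐᵒᵖ ({e} : Set R)) = c * dregForm φ (σ.symm χ :
              Submodule.span Rᵐᵒᵖ ({e} : Set R))
            rw [map_smul σ.symm, ← smul_eq_mul, ← map_smul (dregForm φ), Algebra.smul_def,
              Algebra.commutes]
            rfl
      refine ⟨m, dreg_ext fun x => ?_⟩
      rw [dregForm_dregEndHom, hψ, ← hm]
      change dregForm φ (σ.symm (σ (MulOpposite.op x • g)) :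
        Submodule.span Rᵐᵒᵖ ({e} : Set R)) = _
      rw [σ.symm_apply_apply]
      rfl
  exact ⟨((LinearEquiv.ofInjective ψ hinj).trans (LinearEquiv.ofEq _ _ hrange)).symm⟩

end DualModule

section Main

variable {R : Type} [Ring R] {P T : ModuleCat.{0} R} {k : ℕ}

theorem nonempty_range_moduleEndSelf {e : R} (he : IsIdempotentElem e) :
    Nonempty ((ModuleCat.of R (LinearMap.range
      (RingEquiv.moduleEndSelf R (MulOpposite.op e)))) ≃ₗ[R]
        (ModuleCat.of R (Submodule.span R ({e} : Set R)))) := by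
  refine ⟨LinearEquiv.ofEq _ _ (le_antisymm ?_ ?_)⟩
  · rintro _ ⟨x, rfl⟩
    exact Submodule.mem_span_singleton.2 ⟨x, rfl⟩
  · rw [Submodule.span_singleton_le_iff_mem]
    exact ⟨e, he.eq⟩

theorem IsSpecialTilting.nonempty_stableEnd (K : Type) [Field K] [Algebra K R]
    [FiniteDimensional K R] (hbasic : IsBasic (reg R)) (hP : ProjInj P)
    (hPf : Module.Finite R P) (hTb : IsBasic T) (hT : IsSpecialTilting P k T) :
    Nonempty (StableEnd P T ≃+* StableEnd P (reg R)) := by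
  obtain ⟨⟨hTf, hpd, hext, -⟩, Y, f, hY, h0, hYT, hYP⟩ := hT
  have : IsNoetherianRing R := .of_finite K R
  have hG : Module.Finite R (reg R) := inferInstanceAs (Module.Finite R R)
  have hsh : Shift P k (reg R) (Y (k + 1)) := h0 ▸ hY.exactChain hYP
  have ht := hYT (k + 1) (by lia) le_rfl
  obtain ⟨S, hSf, hSp, hS⟩ := exists_projective_shift hP hext hpd ht hsh
  have hSadd : MemAdd (reg R) S := by
    obtain ⟨n, g, hg⟩ := Module.Finite.exists_fin' R S
    obtain ⟨i, hi⟩ := Module.projective_lifting_property g LinearMap.id hg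
    exact ⟨n, i, g, hi⟩
  obtain ⟨e₁⟩ := hS.nonempty_stableEnd hP
  obtain ⟨e₂⟩ := nonempty_stableEnd_of_isBasic (P := P) K hbasic hTb hSadd ht
    (fun n => (Shift.stableRetract_iff hP hS (hsh.pi n)).1)
    (fun n => (Shift.stableRetract_iff hP hsh (hS.pi n)).2)
    (Shift.stableRetract_iff hP hS hsh).2
  exact ⟨e₁.symm.trans e₂⟩

theorem IsSpecialCotilting.nonempty_stableEnd (K : Type) [Field K] [Algebra K R]
    [FiniteDimensional K R] (hbasic : IsBasic (reg R)) (hP : ProjInj P)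
    (hPf : Module.Finite R P) (hTb : IsBasic T) (hT : IsSpecialCotilting K P k T) :
    Nonempty (StableEnd P T ≃+* StableEnd P (Dreg K R)) := by
  obtain ⟨⟨hTf, hid, hext, -⟩, Y, f, hY, h0, hYT, hYP⟩ := hT
  have hG := finite_Dreg K R
  have hsh : Shift P k (Y 0) (Dreg K R) := h0 ▸ hY.exactChain hYP
  have ht := hYT 0 (Nat.zero_le k)
  obtain ⟨S, hSf, hSi, hS⟩ := exists_injective_shift hP (exists_injective_pi_Dreg K) hext hid ht hsh
  obtain ⟨e₁⟩ := hS.nonempty_stableEnd hP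
  obtain ⟨e₂⟩ := nonempty_stableEnd_of_isBasic (P := P) K (isBasic_Dreg hbasic) hTb
    (memAdd_Dreg hSf hSi) ht
    (fun n => (Shift.stableRetract_iff hP hS (hsh.pi n)).2)
    (fun n => (Shift.stableRetract_iff hP hsh (hS.pi n)).1)
    (Shift.stableRetract_iff hP hS hsh).1
  exact ⟨e₁.trans e₂⟩

end Main
end PS
end

open PS in
/-- Lemma `quotient-algebras`.
Let `domdim Γ = d > 0`, `Π` the maximal projective-injective summand, `Γe₀ ≅ Π ≅ D(e⁰Γ)` for
idempotents `e₀, e⁰ ∈ Γ`, and for `0 ≤ k ≤ d` let `e_k ∈ B_k` (resp. `e^k ∈ B^k`) be an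
idempotent given by projection onto the summand `Π` of `T_k` (resp. of `C^k`).  Then
`B_k/B_k e_k B_k ≅ Γ/Γe₀Γ` and `B^k/B^k e^k B^k ≅ Γ/Γe⁰Γ` as rings. -/
theorem statement13 (K : Type) [Field K] (Γ : Type) [Ring Γ] [Algebra K Γ]
    [FiniteDimensional K Γ] (hbasic : IsBasic (reg Γ)) (d : ℕ)
    (hdom : DomdimEq Γ d) (hd : 0 < d)
    (Pii : ModuleCat.{0} Γ) (hPii : IsMaxProjInjSummand Pii)
    (e0 : Γ) (he0 : IsIdempotentElem e0)
    (he0Pi : Nonempty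
      ((ModuleCat.of Γ (Submodule.span Γ ({e0} : Set Γ))) ≃ₗ[Γ] Pii))
    (e0' : Γ) (he0' : IsIdempotentElem e0')
    (he0'Pi : Nonempty
      ((ModuleCat.of Γᵐᵒᵖ (Submodule.span Γᵐᵒᵖ ({e0'} : Set Γ))) ≃ₗ[Γᵐᵒᵖ] Dmod K Pii)) :
    ∀ k, k ≤ d →
      -- shifted algebras
      ((∀ Tk : ModuleCat.{0} Γ, IsBasic Tk → IsSpecialTilting Pii k Tk →
        ∀ f : Module.End Γ Tk, IsIdempotentElem f →
          Nonempty ((ModuleCat.of Γ (LinearMap.range f)) ≃ₗ[Γ] Pii) →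
          Nonempty
            (RingQuot (fun x y : (Module.End Γ Tk)ᵐᵒᵖ => x = MulOpposite.op f ∧ y = 0) ≃+*
             RingQuot (fun x y : Γ => x = e0 ∧ y = 0))) ∧
      -- coshifted algebras
      (∀ Ck : ModuleCat.{0} Γ, IsBasic Ck → IsSpecialCotilting K Pii k Ck →
        ∀ f : Module.End Γ Ck, IsIdempotentElem f →
          Nonempty ((ModuleCat.of Γ (LinearMap.range f)) ≃ₗ[Γ] Pii) →
          Nonempty
            (RingQuot (fun x y : (Module.End Γ Ck)ᵐᵒᵖ => x = MulOpposite.op f ∧ y = 0) ≃+*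
             RingQuot (fun x y : Γ => x = e0' ∧ y = 0)))) := by
  intro k _
  have hP := hPii.2.1
  have hPf : Module.Finite Γ Pii :=
    have : Module.Finite Γ (reg Γ) := inferInstanceAs (Module.Finite Γ Γ)
    hPii.1.finite
  refine ⟨fun Tk hTb hT f hf hfP => ?_, fun Ck hCb hC f hf hfP => ?_⟩
  · obtain ⟨e⟩ := hT.nonempty_stableEnd K hbasic hP hPf hTb
    obtain ⟨e₁⟩ := nonempty_ringQuot_stableEnd (RingEquiv.refl (Module.End Γ Tk)ᵐᵒᵖ)
      (congrArg MulOpposite.op hf) hfP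
    obtain ⟨e₂⟩ := nonempty_ringQuot_stableEnd (M := reg Γ)
      ((RingEquiv.opOp Γ).trans (RingEquiv.moduleEndSelf Γ).op) he0
      ⟨(nonempty_range_moduleEndSelf he0).some.trans he0Pi.some⟩
    exact ⟨(e₁.trans e.op).trans e₂.symm⟩
  · obtain ⟨e⟩ := hC.nonempty_stableEnd K hbasic hP hPf hCb
    obtain ⟨e₁⟩ := nonempty_ringQuot_stableEnd (RingEquiv.refl (Module.End Γ Ck)ᵐᵒᵖ)
      (congrArg MulOpposite.op hf) hfP
    obtain ⟨e₂⟩ := nonempty_ringQuot_stableEnd (M := Dreg K Γ)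
      ((RingEquiv.opOp Γ).trans (dregEndEquiv K Γ).op) he0'
      (he0'Pi.elim (nonempty_range_dregEndHom he0'))
    exact ⟨(e₁.trans e.op).trans e₂.symm⟩
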